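/- Let g ∈ S₀(ℝ) and let α, β > 0 be such that (g, αℤ×βℤ) is a frame sequence in L²(ℝ), and let γ be its canonical dual window. Then γ ∈ S₀(ℝ). -/

import Mathlib

open MeasureTheory Complex Filter
open scoped ENNReal InnerProductSpace RealInnerProductSpace ComplexConjugate

noncomputable section

/-- The Hilbert space `L²(ℝ)` of complex-valued square-integrable functions. -/
abbrev L2 : Type := Lp ℂ 2 (volume : Measure ℝ)

lemma memLp_translate (a : ℝ) (f : L2) :
    MemLp (fun x : ℝ => f (x - a)) 2 (volume : Measure ℝ) :=
  (Lp.memLp f).comp_measurePreserving (measurePreserving_sub_right volume a)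

lemma memLp_modulate (b : ℝ) (f : L2) :
    MemLp (fun x : ℝ => Complex.exp (2 * Real.pi * Complex.I * (b * x)) * f x) 2
      (volume : Measure ℝ) := by
  refine MemLp.of_le (Lp.memLp f) ?_ ?_
  · exact (Complex.continuous_exp.comp (by fun_prop)).aestronglyMeasurable.mul
      (Lp.aestronglyMeasurable f)
  · filter_upwards with x
    have : Complex.exp (2 * Real.pi * Complex.I * (b * x))
        = Complex.exp ((2 * Real.pi * (b * x) : ℝ) * Complex.I) := by
      push_cast; ring_nf
    rw [norm_mul, this, Complex.norm_exp_ofReal_mul_I, one_mul]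

/-- Translation `T_a` on `L²(ℝ)`: `(T_a f)(x) = f (x - a)`. -/
def Tr (a : ℝ) (f : L2) : L2 := (memLp_translate a f).toLp _

/-- Modulation `M_b` on `L²(ℝ)`: `(M_b f)(x) = e^{2πibx} f x`. -/
def Mo (b : ℝ) (f : L2) : L2 := (memLp_modulate b f).toLp _

/-- Time-frequency shift `π(a,b) = T_a M_b`. -/
def tf (z : ℝ × ℝ) (f : L2) : L2 := Tr z.1 (Mo z.2 f)

/-- The closed linear span `𝒢(g,Λ)` of the Gabor system `(g,Λ)`. -/
def gaborSpan (g : L2) (Λ : Set (ℝ × ℝ)) : Set L2 :=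
  closure (Submodule.span ℂ ((fun z => tf z g) '' Λ) : Set L2)

/-- `𝔍(𝒢)`: the set of time-frequency shifts leaving `𝒢` invariant. -/
def stab (G : Set L2) : Set (ℝ × ℝ) := {z | ∀ f ∈ G, tf z f ∈ G}

/-- `Λ` is a lattice in `ℝ²` if `Λ = Aℤ²` for an invertible `2×2` matrix `A`. -/
def IsLattice (Λ : Set (ℝ × ℝ)) : Prop :=
  ∃ A : Matrix (Fin 2) (Fin 2) ℝ, IsUnit A.det ∧
    Λ = {p : ℝ × ℝ | ∃ k l : ℤ,
      p = (A 0 0 * k + A 0 1 * l, A 1 0 * k + A 1 1 * l)}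

lemma memLp_gaussian : MemLp (fun x : ℝ => (Real.exp (-Real.pi * x ^ 2) : ℂ)) 2
    (volume : Measure ℝ) := by
  rw [memLp_two_iff_integrable_sq_norm]
  · have h : Integrable (fun x : ℝ => Real.exp (-(2 * Real.pi) * x ^ 2)) volume :=
      integrable_exp_neg_mul_sq (by positivity)
    refine h.congr (Eventually.of_forall fun x => ?_)
    simp only [Complex.norm_real, Real.norm_eq_abs, Real.abs_exp, sq, ← Real.exp_add]
    ring_nf
  · exact (Complex.continuous_ofReal.comp (by fun_prop)).aestronglyMeasurable

/-- The Gaussian `φ(x) = e^{-πx²}` as an element of `L²(ℝ)`. -/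
def gaussL2 : L2 := memLp_gaussian.toLp _

/-- The Feichtinger algebra condition: `f ∈ S₀(ℝ)` iff `(a,b) ↦ ⟨f, π(a,b)φ⟩ ∈ L¹(ℝ²)`. -/
def InS0 (f : L2) : Prop :=
  Integrable (fun z : ℝ × ℝ => ⟪tf z gaussL2, f⟫_ℂ) (volume : Measure (ℝ × ℝ))

/-- `(g,Λ)` is a frame for its closed linear span. -/
def IsFrameSeq (g : L2) (Λ : Set (ℝ × ℝ)) : Prop :=
  ∃ A B : ℝ, 0 < A ∧ 0 < B ∧ ∀ f ∈ gaborSpan g Λ,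
    A * ‖f‖ ^ 2 ≤ ∑' lam : Λ, ‖⟪tf (lam : ℝ × ℝ) g, f⟫_ℂ‖ ^ 2 ∧
    ∑' lam : Λ, ‖⟪tf (lam : ℝ × ℝ) g, f⟫_ℂ‖ ^ 2 ≤ B * ‖f‖ ^ 2

/-- `(g,Λ)` is a frame for all of `L²(ℝ)`. -/
def IsFrameL2 (g : L2) (Λ : Set (ℝ × ℝ)) : Prop :=
  ∃ A B : ℝ, 0 < A ∧ 0 < B ∧ ∀ f : L2,
    A * ‖f‖ ^ 2 ≤ ∑' lam : Λ, ‖⟪tf (lam : ℝ × ℝ) g, f⟫_ℂ‖ ^ 2 ∧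
    ∑' lam : Λ, ‖⟪tf (lam : ℝ × ℝ) g, f⟫_ℂ‖ ^ 2 ≤ B * ‖f‖ ^ 2

/-- Euclidean ball of radius `ε` around `a ∈ ℝ²`. -/
def eball (ε : ℝ) (a : ℝ × ℝ) : Set (ℝ × ℝ) :=
  {x : ℝ × ℝ | Real.sqrt ((x.1 - a.1) ^ 2 + (x.2 - a.2) ^ 2) < ε}

/-- `B_ε(Δ) = ⋃_{a ∈ Δ} B_ε(a)`. -/
def eballSet (ε : ℝ) (Δ : Set (ℝ × ℝ)) : Set (ℝ × ℝ) := ⋃ a ∈ Δ, eball ε a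

/-- The separable lattice `αℤ × βℤ`. -/
def sepLattice (α β : ℝ) : Set (ℝ × ℝ) :=
  {p : ℝ × ℝ | ∃ k l : ℤ, p = (α * k, β * l)}


/-- `γ` is the canonical dual window of the frame sequence `(g, αℤ×βℤ)`:
`γ` belongs to `𝒢(g, αℤ×βℤ)` and `Sγ = g` for the frame operator `S`,
the defining series converging unconditionally in `L²`. -/
def IsDualWindow (g γ : L2) (α β : ℝ) : Prop :=
  γ ∈ gaborSpan g (sepLattice α β) ∧
  HasSum (fun lam : sepLattice α β =>
    ⟪tf (lam : ℝ × ℝ) g, γ⟫_ℂ • tf (lam : ℝ × ℝ) g) g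

/-- The space `ℓ¹(G, B)`, regarded as a convolution algebra. -/
abbrev ConvAlg (G B : Type*) [NormedAddCommGroup B] : Type _ := lp (fun _ : G => B) 1

namespace ConvAlg

section Lift

variable {G X Y : Type*} [NormedAddCommGroup X]

lemma summable_norm (x : ConvAlg G X) : Summable fun g => ‖x g‖ := by
  simpa using (lp.memℓp x).summable (by norm_num)

lemma norm_eq_tsum (x : ConvAlg G X) : ‖x‖ = ∑' g, ‖x g‖ := by
  simpa using lp.norm_eq_tsum_rpow (p := 1) (by norm_num) x

lemma hasSum_single [DecidableEq G] (x : ConvAlg G X) :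
    HasSum (fun g => (lp.single 1 g (x g) : ConvAlg G X)) x :=
  lp.hasSum_single ENNReal.one_ne_top x

lemma norm_single [DecidableEq G] (g : G) (b : X) :
    ‖(lp.single 1 g b : ConvAlg G X)‖ = ‖b‖ :=
  lp.norm_single (E := fun _ : G => X) (p := 1) one_pos g b

variable [NormedSpace ℂ X] [NormedAddCommGroup Y] [NormedSpace ℂ Y]

lemma clm_ext [DecidableEq G] {S T : ConvAlg G X →L[ℂ] Y}
    (h : ∀ g b, S (lp.single 1 g b) = T (lp.single 1 g b)) : S = T :=
  lp.ext_continuousLinearMap ENNReal.one_ne_top fun g => by ext b; exact h g b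

variable [CompleteSpace Y]

lemma summable_lift (T : G → X →L[ℂ] Y) (C : ℝ) (hT : ∀ g, ‖T g‖ ≤ C) (x : ConvAlg G X) :
    Summable fun g => T g (x g) :=
  .of_norm_bounded ((summable_norm x).mul_left C) fun g => (T g).le_of_opNorm_le (hT g) _

/-- The operator on `ℓ¹(G, X)` determined by a bounded family of operators on `X`. -/
def lift (T : G → X →L[ℂ] Y) (C : ℝ) (hT : ∀ g, ‖T g‖ ≤ C) : ConvAlg G X →L[ℂ] Y :=
  LinearMap.mkContinuous
    { toFun := fun x => ∑' g, T g (x g)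
      map_add' := fun x y => by
        rw [← (summable_lift T C hT x).tsum_add (summable_lift T C hT y)]
        simp
      map_smul' := fun c x => by
        simp only [lp.coeFn_smul, Pi.smul_apply, map_smul, RingHom.id_apply]
        exact tsum_const_smul'' c } C fun x => by
      rw [norm_eq_tsum, ← tsum_mul_left]
      exact tsum_of_norm_bounded ((summable_norm x).mul_left C).hasSum
        fun g => (T g).le_of_opNorm_le (hT g) _

lemma lift_apply (T : G → X →L[ℂ] Y) (C : ℝ) (hT : ∀ g, ‖T g‖ ≤ C) (x : ConvAlg G X) :
    lift T C hT x = ∑' g, T g (x g) := rfl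

lemma hasSum_lift (T : G → X →L[ℂ] Y) (C : ℝ) (hT : ∀ g, ‖T g‖ ≤ C) (x : ConvAlg G X) :
    HasSum (fun g => T g (x g)) (lift T C hT x) :=
  (summable_lift T C hT x).hasSum

lemma lift_single [DecidableEq G] (T : G → X →L[ℂ] Y) (C : ℝ) (hT : ∀ g, ‖T g‖ ≤ C) (g : G)
    (b : X) : lift T C hT (lp.single 1 g b) = T g b := by
  rw [lift_apply, tsum_eq_single g fun h hh => by rw [lp.single_apply_ne _ _ _ hh, map_zero],
    lp.single_apply_self]

end Lift

section Algebra

variable {G B : Type*} [NormedRing B]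

lemma summable_norm_conv (x y : ConvAlg G B) :
    Summable fun p : G × G => ‖x p.1‖ * ‖y p.2‖ :=
  (summable_norm x).mul_of_nonneg (summable_norm y) (fun _ => norm_nonneg _)
    fun _ => norm_nonneg _

variable [AddCommGroup G] [DecidableEq G]

lemma norm_conv_term_le (x y : ConvAlg G B) (p : G × G) :
    ‖(lp.single 1 (p.1 + p.2) (x p.1 * y p.2) : ConvAlg G B)‖ ≤ ‖x p.1‖ * ‖y p.2‖ := by
  rw [norm_single]
  exact norm_mul_le _ _

variable [CompleteSpace B]

lemma summable_conv (x y : ConvAlg G B) :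
    Summable fun p : G × G => (lp.single 1 (p.1 + p.2) (x p.1 * y p.2) : ConvAlg G B) :=
  .of_norm_bounded (summable_norm_conv x y) (norm_conv_term_le x y)

variable [NormedAlgebra ℂ B]

/-- Convolution on `ℓ¹(G, B)` as a continuous bilinear map. -/
def conv : ConvAlg G B →L[ℂ] ConvAlg G B →L[ℂ] ConvAlg G B :=
  LinearMap.mkContinuous₂
    (LinearMap.mk₂ ℂ
      (fun x y : ConvAlg G B =>
        ∑' p : G × G, (lp.single 1 (p.1 + p.2) (x p.1 * y p.2) : ConvAlg G B))
      (fun x x' y => by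
        rw [← (summable_conv x y).tsum_add (summable_conv x' y)]
        simp [add_mul])
      (fun c x y => by
        rw [← tsum_const_smul'' c]
        simp [lp.single_smul])
      (fun x y y' => by
        rw [← (summable_conv x y).tsum_add (summable_conv x y')]
        simp [mul_add])
      (fun c x y => by
        rw [← tsum_const_smul'' c]
        simp [lp.single_smul])) 1 fun x y => by
    rw [one_mul, norm_eq_tsum x, norm_eq_tsum y,
      (summable_norm x).tsum_mul_tsum (summable_norm y) (summable_norm_conv x y)]
    exact tsum_of_norm_bounded (summable_norm_conv x y).hasSum (norm_conv_term_le x y)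

lemma conv_apply (x y : ConvAlg G B) :
    conv x y = ∑' p : G × G, (lp.single 1 (p.1 + p.2) (x p.1 * y p.2) : ConvAlg G B) := rfl

lemma conv_single_single (g h : G) (a b : B) :
    conv (lp.single 1 g a) (lp.single 1 h b) = (lp.single 1 (g + h) (a * b) : ConvAlg G B) := by
  rw [conv_apply, tsum_eq_single (g, h)]
  · simp only [lp.single_apply_self]
  · rintro ⟨g', h'⟩ hne
    by_cases hg : g' = g
    · have hh : h' ≠ h := fun hh => hne (by rw [hg, hh])
      rw [lp.single_apply_ne _ _ _ hh, mul_zero, lp.single_zero]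
    · rw [lp.single_apply_ne _ _ _ hg, zero_mul, lp.single_zero]

lemma conv_assoc (x y z : ConvAlg G B) : conv (conv x y) z = conv x (conv y z) := by
  have hz (g h : G) (a b : B) :
      conv (conv (lp.single 1 g a) (lp.single 1 h b)) =
        (conv (lp.single 1 g a)).comp (conv (G := G) (lp.single 1 h b)) :=
    clm_ext fun k c => by simp [conv_single_single, add_assoc, mul_assoc]
  have hy (g : G) (a : B) : ((conv (G := G) (B := B)).flip z).comp (conv (lp.single 1 g a)) =
      (conv (lp.single 1 g a)).comp (conv.flip z) :=
    clm_ext fun h b => by simpa using DFunLike.congr_fun (hz g h a b) z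
  have hx : (conv.flip z).comp ((conv (G := G) (B := B)).flip y) = conv.flip (conv y z) :=
    clm_ext fun g a => by simpa using DFunLike.congr_fun (hy g a) y
  simpa using DFunLike.congr_fun hx x

lemma one_conv (x : ConvAlg G B) : conv (lp.single 1 0 1) x = x := by
  have : conv (G := G) (B := B) (lp.single 1 0 1) = .id ℂ _ :=
    clm_ext fun g b => by simp [conv_single_single]
  simpa using DFunLike.congr_fun this x

lemma conv_one (x : ConvAlg G B) : conv x (lp.single 1 0 1) = x := by
  have : (conv (G := G) (B := B)).flip (lp.single 1 0 1) = .id ℂ _ :=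
    clm_ext fun g b => by simp [conv_single_single]
  simpa using DFunLike.congr_fun this x

lemma norm_conv_le (x y : ConvAlg G B) : ‖conv x y‖ ≤ ‖x‖ * ‖y‖ := by
  rw [conv_apply, norm_eq_tsum x, norm_eq_tsum y,
    (summable_norm x).tsum_mul_tsum (summable_norm y) (summable_norm_conv x y)]
  exact tsum_of_norm_bounded (summable_norm_conv x y).hasSum (norm_conv_term_le x y)

instance : NormedRing (ConvAlg G B) :=
  { (inferInstance : NormedAddCommGroup (ConvAlg G B)) with
    mul := fun x y => conv x y
    one := lp.single 1 0 1
    left_distrib := fun x y z => map_add (conv x) y z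
    right_distrib := fun x y z => by
      change conv (x + y) z = conv x z + conv y z
      simp
    zero_mul := fun x => by
      change conv 0 x = 0
      simp
    mul_zero := fun x => map_zero (conv x)
    mul_assoc := conv_assoc
    one_mul := one_conv
    mul_one := conv_one
    dist_eq := fun x y => NormedAddGroup.dist_eq x y
    norm_mul_le := norm_conv_le }

lemma mul_eq_conv (x y : ConvAlg G B) : x * y = conv x y := rfl

lemma one_eq_single : (1 : ConvAlg G B) = lp.single 1 0 1 := rfl

instance : NormedAlgebra ℂ (ConvAlg G B) :=
  { Algebra.ofModule (fun c x y => by simp [mul_eq_conv]) (fun c x y => by simp [mul_eq_conv])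
      with
    norm_smul_le := fun c x => norm_smul_le c x }

lemma single_mul_single (g h : G) (a b : B) :
    (lp.single 1 g a * lp.single 1 h b : ConvAlg G B) = lp.single 1 (g + h) (a * b) :=
  conv_single_single g h a b

lemma single_one_mul_comm (g : G) (x : ConvAlg G B) :
    lp.single 1 g 1 * x = x * lp.single 1 g 1 := by
  have : conv (G := G) (B := B) (lp.single 1 g 1) = conv.flip (lp.single 1 g 1) :=
    clm_ext fun h b => by simp [conv_single_single, add_comm]
  exact DFunLike.congr_fun this x

/-- Evaluation of the Fourier series with coefficients `x : ℓ¹(G, B)` at a character. -/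
def ev (χ : AddChar G Circle) : ConvAlg G B →L[ℂ] B :=
  lift (fun g => (χ g : ℂ) • ContinuousLinearMap.id ℂ B) 1 fun g => by
    rw [norm_smul, Circle.norm_coe, one_mul]
    exact ContinuousLinearMap.norm_id_le

lemma ev_single (χ : AddChar G Circle) (g : G) (b : B) :
    ev χ (lp.single 1 g b) = (χ g : ℂ) • b := by
  simp [ev, lift_single]

lemma hasSum_ev (χ : AddChar G Circle) (x : ConvAlg G B) :
    HasSum (fun g => (χ g : ℂ) • x g) (ev χ x) := by
  simpa [ev] using hasSum_lift (fun g => (χ g : ℂ) • ContinuousLinearMap.id ℂ B) 1 _ x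

lemma ev_one (χ : AddChar G Circle) : ev χ (1 : ConvAlg G B) = 1 := by
  rw [one_eq_single, ev_single]
  simp

lemma ev_mul (χ : AddChar G Circle) (x y : ConvAlg G B) : ev χ (x * y) = ev χ x * ev χ y := by
  have hy (g : G) (a : B) : (ev χ).comp (conv (lp.single 1 g a)) =
      (ContinuousLinearMap.mul ℂ B (ev χ (lp.single 1 g a))).comp (ev (G := G) χ) :=
    clm_ext fun h b => by
      simp only [ContinuousLinearMap.comp_apply, conv_single_single, ev_single,
        ContinuousLinearMap.mul_apply', AddChar.map_add_eq_mul, Circle.coe_mul, smul_mul_smul_comm]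
  have hx : (ev χ).comp (conv.flip y) =
      ((ContinuousLinearMap.mul ℂ B).flip (ev χ y)).comp (ev (G := G) χ) :=
    clm_ext fun g a => by simpa using DFunLike.congr_fun (hy g a) y
  exact DFunLike.congr_fun hx x

end Algebra

end ConvAlg

/-- Modulo a maximal left ideal of a complex Banach algebra, every central element is a scalar. -/
lemma exists_sub_algebraMap_mem_of_isMaximal {R : Type*} [NormedRing R] [NormedAlgebra ℂ R]
    [CompleteSpace R] (L : Ideal R) [hL : L.IsMaximal] (u : R) (hu : ∀ r, u * r = r * u) :
    ∃ c : ℂ, u - algebraMap ℂ R c ∈ L := by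
  let L' : Submodule ℂ R := L.restrictScalars ℂ
  have hmem (r : R) : r ∈ L' ↔ r ∈ L := Iff.rfl
  have hcl : IsClosed (L' : Set R) := (inferInstance : IsClosed (L : Set R))
  have : CompleteSpace (R ⧸ L') := inferInstance
  have : Nontrivial (R ⧸ L') := by
    refine Submodule.Quotient.nontrivial_iff.2 fun h => hL.ne_top ?_
    rw [Ideal.eq_top_iff_one, ← hmem, h]
    trivial
  let mu : (R ⧸ L') →L[ℂ] (R ⧸ L') :=
    { toLinearMap := L'.mapQ L' (LinearMap.mulLeft ℂ u) fun r hr => L.mul_mem_left u hr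
      cont := by
        refine continuous_quot_lift _ ?_
        exact continuous_quot_mk.comp (continuous_const.mul continuous_id) }
  have hmu (r : R) : mu (L'.mkQ r) = L'.mkQ (u * r) := rfl
  obtain ⟨c, hc⟩ := spectrum.nonempty mu
  refine ⟨c, ?_⟩
  by_contra hnot
  refine hc ?_
  set v := u - algebraMap ℂ R c with hv
  have hvc (r : R) : v * r = r * v := by
    rw [hv, sub_mul, mul_sub, hu, Algebra.commutes]
  have hap (r : R) : (algebraMap ℂ ((R ⧸ L') →L[ℂ] (R ⧸ L')) c - mu) (L'.mkQ r) =
      -L'.mkQ (v * r) := by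
    rw [sub_apply, hmu, ContinuousLinearMap.algebraMap_apply, hv, sub_mul,
      map_sub, neg_sub, ← Algebra.smul_def, map_smul]
  rw [spectrum.mem_resolventSet_iff, ContinuousLinearMap.isUnit_iff_bijective]
  constructor
  · rw [injective_iff_map_eq_zero]
    intro q hq
    obtain ⟨r, rfl⟩ := L'.mkQ_surjective q
    rw [hap, neg_eq_zero, Submodule.mkQ_apply, Submodule.Quotient.mk_eq_zero, hmem, hvc] at hq
    let N : Ideal R := Submodule.comap (LinearMap.toSpanSingleton R R v) L
    have hN (s : R) : s ∈ N ↔ s * v ∈ L := Iff.rfl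
    have hLN : L ≤ N := fun s hs => by
      rw [hN, ← hvc]
      exact L.mul_mem_left v hs
    have hNtop : N ≠ ⊤ := fun h => hnot (by
      have := (hN 1).1 (h ▸ trivial)
      rwa [one_mul] at this)
    have hr : r ∈ N := hq
    rw [← hL.eq_of_le hNtop hLN] at hr
    rw [Submodule.mkQ_apply, Submodule.Quotient.mk_eq_zero]
    exact hr
  · intro q
    obtain ⟨s, rfl⟩ := L'.mkQ_surjective q
    have htop : L ⊔ Ideal.span {v} = ⊤ := by
      refine hL.1.2 _ (lt_of_le_of_ne le_sup_left fun h => hnot ?_)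
      rw [h]
      exact Submodule.mem_sup_right (Ideal.mem_span_singleton_self v)
    have h1 : (1 : R) ∈ L ⊔ Ideal.span {v} := htop ▸ trivial
    obtain ⟨l, hl, w, hw, hlw⟩ := Submodule.mem_sup.1 h1
    obtain ⟨t, rfl⟩ := Ideal.mem_span_singleton'.1 hw
    refine ⟨L'.mkQ (-(s * t)), ?_⟩
    rw [hap, mul_neg, map_neg, neg_neg, hvc, ← sub_eq_zero, ← map_sub, Submodule.mkQ_apply,
      Submodule.Quotient.mk_eq_zero, hmem]
    have : s * t * v - s = -(s * l) := by
      rw [eq_neg_iff_add_eq_zero, sub_add_eq_add_sub, sub_eq_zero, mul_assoc, ← mul_add,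
        add_comm, hlw, mul_one]
    rw [this]
    exact L.neg_mem (L.mul_mem_left s hl)

namespace ConvAlg

variable {G B : Type*} [AddCommGroup G] [DecidableEq G] [NormedRing B] [NormedAlgebra ℂ B]
  [CompleteSpace B] [NormOneClass B]

/-- A maximal left ideal of `ℓ¹(G, B)` contains the kernel of evaluation at some character. -/
lemma exists_char_sub_mem (L : Ideal (ConvAlg G B)) [hL : L.IsMaximal] :
    ∃ χ : AddChar G Circle, ∀ y : ConvAlg G B, y - lp.single 1 0 (ev χ y) ∈ L := by
  choose χ hχ using fun g : G => exists_sub_algebraMap_mem_of_isMaximal L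
    (lp.single 1 g 1 : ConvAlg G B) (single_one_mul_comm g)
  have huniq {a b : ℂ} {w : ConvAlg G B} (ha : w - algebraMap ℂ _ a ∈ L)
      (hb : w - algebraMap ℂ _ b ∈ L) : a = b := by
    by_contra hne
    refine hL.ne_top (L.eq_top_of_isUnit_mem (x := algebraMap ℂ (ConvAlg G B) (b - a)) ?_ ?_)
    · have := L.sub_mem ha hb
      rwa [sub_sub_sub_cancel_left, ← map_sub] at this
    · exact (IsUnit.mk0 _ (sub_ne_zero.2 (Ne.symm hne))).map _
  have h0 : χ 0 = 1 := huniq (hχ 0) (by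
    rw [map_one, ← one_eq_single, sub_self]
    exact L.zero_mem)
  have hadd (g h : G) : χ (g + h) = χ g * χ h := by
    refine huniq (hχ (g + h)) ?_
    have e : (lp.single 1 (g + h) 1 : ConvAlg G B) - algebraMap ℂ _ (χ g * χ h) =
        lp.single 1 g 1 * (lp.single 1 h 1 - algebraMap ℂ _ (χ h)) +
        algebraMap ℂ _ (χ h) * (lp.single 1 g 1 - algebraMap ℂ _ (χ g)) := by
      rw [mul_sub, mul_sub, single_mul_single, mul_one, map_mul,
        ← Algebra.commutes (χ h) (lp.single 1 g 1 : ConvAlg G B),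
        ← Algebra.commutes (χ h) (algebraMap ℂ (ConvAlg G B) (χ g))]
      abel
    rw [e]
    exact L.add_mem (L.mul_mem_left _ (hχ h)) (L.mul_mem_left _ (hχ g))
  have hle (g : G) : ‖χ g‖ ≤ 1 := by
    have hs : χ g ∈ spectrum ℂ (lp.single 1 g 1 : ConvAlg G B) := fun hu => by
      refine hL.ne_top (L.eq_top_of_isUnit_mem ?_ hu)
      rw [← neg_sub]
      exact L.neg_mem (hχ g)
    refine (spectrum.norm_le_norm_mul_of_mem hs).trans ?_
    rw [one_eq_single, norm_single, norm_single, norm_one, one_mul]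
  have hnorm (g : G) : ‖χ g‖ = 1 := by
    refine le_antisymm (hle g) ?_
    have : ‖χ g‖ * ‖χ (-g)‖ = 1 := by rw [← norm_mul, ← hadd, add_neg_cancel, h0, norm_one]
    nlinarith [hle (-g), norm_nonneg (χ g)]
  let ψ : AddChar G Circle :=
    { toFun := fun g => ⟨χ g, mem_sphere_zero_iff_norm.2 (hnorm g)⟩
      map_zero_eq_one' := Circle.ext h0
      map_add_eq_mul' := fun g h => Circle.ext (hadd g h) }
  refine ⟨ψ, fun y => ?_⟩
  have hsum : HasSum (fun g => (lp.single 1 g (y g) : ConvAlg G B) -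
      lp.single 1 0 ((ψ g : ℂ) • y g)) (y - lp.single 1 0 (ev ψ y)) :=
    (hasSum_single y).sub ((hasSum_ev ψ y).mapL
      (lp.singleContinuousLinearMap ℂ (fun _ : G => B) 1 0))
  refine (inferInstance : IsClosed (L : Set (ConvAlg G B))).mem_of_tendsto hsum
    (Eventually.of_forall fun s => L.sum_mem fun g _ => ?_)
  have e : (lp.single 1 g (y g) : ConvAlg G B) - lp.single 1 0 ((ψ g : ℂ) • y g) =
      lp.single 1 0 (y g) * (lp.single 1 g 1 - algebraMap ℂ _ (χ g)) := by
    rw [mul_sub, single_mul_single, zero_add, mul_one, ← Algebra.commutes, ← Algebra.smul_def,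
      lp.single_smul]
    rfl
  rw [e]
  exact L.mul_mem_left _ (hχ g)

lemma exists_mul_eq_one (x : ConvAlg G B) (hx : ∀ χ : AddChar G Circle, IsUnit (ev χ x)) :
    ∃ y : ConvAlg G B, y * x = 1 := by
  by_contra hnot
  have hspan : Ideal.span {x} ≠ ⊤ := fun h => hnot (by
    have h1 : (1 : ConvAlg G B) ∈ Ideal.span {x} := h ▸ trivial
    exact Ideal.mem_span_singleton'.1 h1)
  obtain ⟨L, hL, hle⟩ := Ideal.exists_le_maximal _ hspan
  obtain ⟨χ, hχ⟩ := exists_char_sub_mem L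
  obtain ⟨b, hb⟩ := (hx χ).exists_left_inv
  refine hL.ne_top (L.eq_top_iff_one.2 ?_)
  have hxL : x ∈ L := hle (Ideal.mem_span_singleton_self x)
  have hc : (lp.single 1 0 (ev χ x) : ConvAlg G B) ∈ L := by
    simpa using L.sub_mem hxL (hχ x)
  have := L.mul_mem_left (lp.single 1 0 b) hc
  rwa [single_mul_single, add_zero, hb, ← one_eq_single] at this

/-- **Wiener's lemma** for Banach-algebra-valued absolutely convergent Fourier series: an element
of `ℓ¹(G, B)` whose evaluation at every character is invertible is itself invertible. -/
theorem isUnit_of_forall_ev (x : ConvAlg G B) (hx : ∀ χ : AddChar G Circle, IsUnit (ev χ x)) :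
    IsUnit x := by
  obtain ⟨y, hy⟩ := exists_mul_eq_one x hx
  obtain ⟨z, hz⟩ := exists_mul_eq_one y fun χ => by
    have h1 : ev χ y * ev χ x = 1 := by rw [← ev_mul, hy, ev_one]
    obtain ⟨u, hu⟩ := hx χ
    rw [← hu] at h1
    rw [show ev χ y = ↑u⁻¹ from (Units.eq_inv_of_mul_eq_one_right h1)]
    exact u⁻¹.isUnit
  have hzx : z = x := left_inv_eq_right_inv hz hy
  exact ⟨⟨x, y, hzx ▸ hz, hy⟩, rfl⟩

end ConvAlg

/-- The Hilbert space `ℓ²(G)`. -/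
abbrev SeqL2 (G : Type*) : Type _ := lp (fun _ : G => ℂ) 2

namespace SeqL2

variable {G : Type*}

lemma summable_sq (f : SeqL2 G) : Summable fun n => ‖f n‖ ^ 2 := by
  have h := (lp.memℓp f).summable (by norm_num)
  norm_num at h
  exact h

lemma norm_sq_eq_tsum (f : SeqL2 G) : ‖f‖ ^ 2 = ∑' n, ‖f n‖ ^ 2 := by
  have h := lp.norm_rpow_eq_tsum (p := 2) (by norm_num) f
  norm_num at h
  exact h

lemma memℓp_of_summable_sq {f : G → ℂ} (h : Summable fun n => ‖f n‖ ^ 2) : Memℓp f 2 := by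
  refine memℓp_gen ?_
  norm_num
  exact h

lemma norm_single_one [DecidableEq G] (m : G) : ‖(lp.single 2 m 1 : SeqL2 G)‖ = 1 := by
  rw [lp.norm_single (E := fun _ : G => ℂ) (p := 2) (by norm_num), norm_one]

/-- The weighted permutation operator `f ↦ (n ↦ w n * f (σ n))` on `ℓ²(G)`. -/
def weightedPerm (w : G → Circle) (σ : G ≃ G) : SeqL2 G →L[ℂ] SeqL2 G :=
  LinearMap.mkContinuous
    { toFun := fun f => ⟨fun n => (w n : ℂ) * f (σ n), memℓp_of_summable_sq (by
        simpa only [norm_mul, Circle.norm_coe, one_mul, Function.comp_def] using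
          σ.summable_iff.2 (summable_sq f))⟩
      map_add' := fun f g => by
        ext n
        exact mul_add _ _ _
      map_smul' := fun c f => by
        ext n
        exact mul_left_comm _ _ _ } 1 fun f => by
      rw [one_mul, ← sq_le_sq₀ (norm_nonneg _) (norm_nonneg _), norm_sq_eq_tsum, norm_sq_eq_tsum,
        ← σ.tsum_eq fun n => ‖f n‖ ^ 2]
      refine le_of_eq (tsum_congr fun n => ?_)
      change ‖(w n : ℂ) * f (σ n)‖ ^ 2 = ‖f (σ n)‖ ^ 2
      rw [norm_mul, Circle.norm_coe, one_mul]

lemma norm_weightedPerm_le (w : G → Circle) (σ : G ≃ G) : ‖weightedPerm w σ‖ ≤ 1 :=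
  LinearMap.mkContinuous_norm_le _ zero_le_one _

variable [AddCommGroup G]

/-- The diagonal operator on `ℓ²(G)` given by a character. -/
def charMul (χ : AddChar G Circle) : SeqL2 G →L[ℂ] SeqL2 G := weightedPerm χ (Equiv.refl G)

lemma charMul_apply (χ : AddChar G Circle) (f : SeqL2 G) (n : G) :
    charMul χ f n = (χ n : ℂ) * f n := rfl

lemma charMul_mul (χ ψ : AddChar G Circle) : charMul χ * charMul ψ = charMul (χ * ψ) := by
  ext f n
  simp [charMul_apply, mul_assoc]

lemma charMul_one : charMul (1 : AddChar G Circle) = 1 := by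
  ext f n
  simp [charMul_apply]

lemma isUnit_charMul (χ : AddChar G Circle) : IsUnit (charMul χ) :=
  ⟨⟨charMul χ, charMul χ⁻¹, by rw [charMul_mul, mul_inv_cancel, charMul_one],
    by rw [charMul_mul, inv_mul_cancel, charMul_one]⟩, rfl⟩

/-- The twisted shift by `m` on `ℓ²(G)`, mapping the unit vector `e_n` to `θ m n • e_{n + m}`. -/
def twistedShift (θ : G → AddChar G Circle) (m : G) : SeqL2 G →L[ℂ] SeqL2 G :=
  weightedPerm (fun n => θ m (n - m)) (Equiv.subRight m)

variable (θ : G → AddChar G Circle)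

lemma twistedShift_apply (m : G) (f : SeqL2 G) (n : G) :
    twistedShift θ m f n = (θ m (n - m) : ℂ) * f (n - m) := rfl

lemma charMul_mul_twistedShift (χ : AddChar G Circle) (m : G) :
    charMul χ * twistedShift θ m = (χ m : ℂ) • (twistedShift θ m * charMul χ) := by
  ext f n
  have h : (χ n : ℂ) = χ m * χ (n - m) := by
    rw [← Circle.coe_mul, ← AddChar.map_add_eq_mul, add_sub_cancel]
  simp only [mul_apply_eq_comp, smul_apply, lp.coeFn_smul, Pi.smul_apply, charMul_apply,
    twistedShift_apply, smul_eq_mul, h]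
  ring

lemma twistedShift_mul_twistedShift (hθ : ∀ m n, θ (m + n) = θ m * θ n) (m n : G) :
    twistedShift θ m * twistedShift θ n = (θ m n : ℂ) • twistedShift θ (m + n) := by
  ext f k
  have h : (θ m (k - m) : ℂ) = θ m n * θ m (k - (m + n)) := by
    rw [← Circle.coe_mul, ← AddChar.map_add_eq_mul]
    congr 2
    abel
  simp only [mul_apply_eq_comp, smul_apply, lp.coeFn_smul, Pi.smul_apply,
    twistedShift_apply, smul_eq_mul, h, sub_sub, hθ, AddChar.mul_apply, Circle.coe_mul]
  ring

variable [DecidableEq G]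

instance : Nontrivial (SeqL2 G) :=
  ⟨lp.single 2 0 1, 0, fun h => by simpa [h] using norm_single_one (0 : G)⟩

lemma twistedShift_single_zero (m : G) :
    twistedShift θ m (lp.single 2 0 1) = lp.single 2 m 1 := by
  ext n
  rw [twistedShift_apply]
  by_cases h : n = m
  · subst h
    simp
  · rw [lp.single_apply_ne _ _ _ (sub_ne_zero.2 h), lp.single_apply_ne _ _ _ h, mul_zero]

/-- The matrix coefficient `T ↦ ⟨e_m, T e_0⟩`. -/
def coeffZero (m : G) : (SeqL2 G →L[ℂ] SeqL2 G) →L[ℂ] ℂ :=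
  (lp.evalCLM ℂ (fun _ : G => ℂ) 2 m).comp
    (ContinuousLinearMap.apply ℂ (SeqL2 G) (lp.single 2 0 1))

lemma coeffZero_apply (m : G) (T : SeqL2 G →L[ℂ] SeqL2 G) :
    coeffZero m T = T (lp.single 2 0 1) m := rfl

lemma norm_coeffZero_apply_le (m : G) (T : SeqL2 G →L[ℂ] SeqL2 G) : ‖coeffZero m T‖ ≤ ‖T‖ := by
  refine (lp.norm_apply_le_norm (by norm_num) _ m).trans ((T.le_opNorm _).trans ?_)
  rw [norm_single_one, mul_one]

lemma coeffZero_twistedShift_self (m : G) : coeffZero m (twistedShift θ m) = 1 := by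
  rw [coeffZero_apply, twistedShift_single_zero, lp.single_apply_self]

lemma coeffZero_twistedShift_mul (m n : G) (T : SeqL2 G →L[ℂ] SeqL2 G) :
    coeffZero (m + n) (twistedShift θ m * T) = (θ m n : ℂ) * coeffZero n T := by
  rw [coeffZero_apply, mul_apply_eq_comp, twistedShift_apply, coeffZero_apply,
    add_sub_cancel_left]

end SeqL2

namespace ConvAlg

open SeqL2

variable {G : Type*} [AddCommGroup G] [DecidableEq G] (θ : G → AddChar G Circle)

/-- The projection of `ℓ¹(G, B(ℓ²(G)))` onto the twisted group algebra, which consists of the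
elements whose coefficient at each `g` is a multiple of the twisted shift by `g`. -/
def twistedProj :
    ConvAlg G (SeqL2 G →L[ℂ] SeqL2 G) →L[ℂ] ConvAlg G (SeqL2 G →L[ℂ] SeqL2 G) :=
  lift (fun g => (coeffZero g).smulRight (lp.single 1 g (twistedShift θ g))) 1 fun g => by
    refine ContinuousLinearMap.opNorm_le_bound _ zero_le_one fun T => ?_
    rw [ContinuousLinearMap.smulRight_apply, norm_smul, norm_single, one_mul]
    exact mul_le_of_le_one_right (norm_nonneg _) (norm_weightedPerm_le _ _) |>.trans
      (norm_coeffZero_apply_le g T)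

lemma twistedProj_single (g : G) (T : SeqL2 G →L[ℂ] SeqL2 G) :
    twistedProj θ (lp.single 1 g T) = lp.single 1 g (coeffZero g T • twistedShift θ g) := by
  rw [twistedProj, lift_single, ContinuousLinearMap.smulRight_apply, lp.single_smul]

lemma twistedProj_apply (x : ConvAlg G (SeqL2 G →L[ℂ] SeqL2 G)) (g : G) :
    twistedProj θ x g = coeffZero g (x g) • twistedShift θ g := by
  have h : (lp.evalCLM ℂ (fun _ : G => SeqL2 G →L[ℂ] SeqL2 G) 1 g).comp (twistedProj θ) =
      ((coeffZero g).smulRight (twistedShift θ g)).comp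
        (lp.evalCLM ℂ (fun _ : G => SeqL2 G →L[ℂ] SeqL2 G) 1 g) := by
    refine clm_ext fun k T => ?_
    change twistedProj θ (lp.single 1 k T) g =
      coeffZero g ((lp.single 1 k T : ConvAlg G (SeqL2 G →L[ℂ] SeqL2 G)) g) • twistedShift θ g
    rw [twistedProj_single]
    by_cases h : g = k
    · subst h
      simp only [lp.single_apply_self]
    · simp only [lp.single_apply_ne _ _ _ h, map_zero, zero_smul]
  exact DFunLike.congr_fun h x

lemma twistedProj_one (hθ : ∀ m n, θ (m + n) = θ m * θ n) : twistedProj θ 1 = 1 := by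
  have h0 : twistedShift θ 0 = 1 := by
    have h1 : θ 0 = 1 := by simpa using hθ 0 0
    ext f n
    simp [twistedShift_apply, h1]
  rw [one_eq_single, twistedProj_single, ← h0, coeffZero_twistedShift_self, one_smul]

lemma twistedProj_mul (hθ : ∀ m n, θ (m + n) = θ m * θ n)
    (x y : ConvAlg G (SeqL2 G →L[ℂ] SeqL2 G)) :
    twistedProj θ (twistedProj θ x * y) = twistedProj θ x * twistedProj θ y := by
  have hy (g : G) (T : SeqL2 G →L[ℂ] SeqL2 G) :
      (twistedProj θ).comp (conv (twistedProj θ (lp.single 1 g T))) =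
        (conv (twistedProj θ (lp.single 1 g T))).comp (twistedProj θ) :=
    clm_ext fun h S => by
      simp only [ContinuousLinearMap.comp_apply, twistedProj_single, conv_single_single,
        smul_mul_assoc, mul_smul_comm, map_smul, coeffZero_twistedShift_mul,
        twistedShift_mul_twistedShift θ hθ, smul_eq_mul, smul_smul]
      congr 2
      ring
  have hx : (twistedProj θ).comp ((conv.flip y).comp (twistedProj θ)) =
      (conv.flip (twistedProj θ y)).comp (twistedProj θ) :=
    clm_ext fun g T => by simpa using DFunLike.congr_fun (hy g T) y
  exact DFunLike.congr_fun hx x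

lemma ev_twistedProj (χ : AddChar G Circle) (x : ConvAlg G (SeqL2 G →L[ℂ] SeqL2 G)) :
    ev χ (twistedProj θ x) * charMul χ = charMul χ * ev 1 (twistedProj θ x) := by
  have h : ((ContinuousLinearMap.mul ℂ _).flip (charMul χ)).comp ((ev χ).comp (twistedProj θ)) =
      (ContinuousLinearMap.mul ℂ _ (charMul χ)).comp ((ev 1).comp (twistedProj θ)) :=
    clm_ext fun g T => by
      simp [twistedProj_single, ev_single, charMul_mul_twistedShift, smul_smul, mul_comm]
  exact DFunLike.congr_fun h x

lemma ev_one_twistedProj_single (x : ConvAlg G (SeqL2 G →L[ℂ] SeqL2 G)) :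
    HasSum (fun g => coeffZero g (x g) • (lp.single 2 g 1 : SeqL2 G))
      (ev 1 (twistedProj θ x) (lp.single 2 0 1)) := by
  have h := (hasSum_ev 1 (twistedProj θ x)).mapL
    (ContinuousLinearMap.apply ℂ (SeqL2 G) (lp.single 2 0 1))
  simpa [twistedProj_apply, twistedShift_single_zero] using h

/-- The twisted group algebra is inverse-closed in `B(ℓ²(G))`. -/
theorem isUnit_of_isUnit_ev_one (x : ConvAlg G (SeqL2 G →L[ℂ] SeqL2 G))
    (hx : twistedProj θ x = x) (hu : IsUnit (ev 1 x)) : IsUnit x := by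
  refine isUnit_of_forall_ev x fun χ => ?_
  have h := ev_twistedProj θ χ x
  rw [hx] at h
  have h' : IsUnit (ev χ x * charMul χ) := h ▸ (isUnit_charMul χ).mul hu
  obtain ⟨u, hu'⟩ := isUnit_charMul χ
  rw [← hu', Units.isUnit_mul_units] at h'
  exact h'

lemma twistedProj_eq_of_mul_eq_one (hθ : ∀ m n, θ (m + n) = θ m * θ n)
    {x y : ConvAlg G (SeqL2 G →L[ℂ] SeqL2 G)} (hx : twistedProj θ x = x) (hxy : x * y = 1)
    (hyx : y * x = 1) : twistedProj θ y = y := by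
  have h := twistedProj_mul θ hθ x y
  rw [hx, hxy, twistedProj_one θ hθ] at h
  exact (left_inv_eq_right_inv hyx h.symm).symm

end ConvAlg

section Contour

lemma ContinuousLinearMap.circleIntegral_comp_comm {X Y : Type*} [NormedAddCommGroup X]
    [NormedSpace ℂ X] [CompleteSpace X] [NormedAddCommGroup Y] [NormedSpace ℂ Y] [CompleteSpace Y]
    (L : X →L[ℂ] Y) {f : ℂ → X} {c : ℂ} {r : ℝ} (hf : CircleIntegrable f c r) :
    ∮ z in C(c, r), L (f z) = L (∮ z in C(c, r), f z) := by
  rw [circleIntegral, circleIntegral, ← L.intervalIntegral_comp_comm hf.out]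
  simp only [map_smul]

variable {B : Type*} [NormedRing B] [NormedAlgebra ℂ B] {a : B} {A M : ℝ}

lemma sub_mul_resolvent {z : ℂ} (hz : z ∈ resolventSet ℂ a) :
    (algebraMap ℂ B z - a) * resolvent a z = 1 := Ring.mul_inverse_cancel _ hz

lemma resolvent_mul_sub {z : ℂ} (hz : z ∈ resolventSet ℂ a) :
    resolvent a z * (algebraMap ℂ B z - a) = 1 := Ring.inverse_mul_cancel _ hz

variable [CompleteSpace B]

lemma continuousOn_inv_smul_resolvent (hA : 0 < A)
    (hres : ∀ z : ℂ, z ≠ 0 → ‖z‖ < A → z ∈ resolventSet ℂ a) :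
    ContinuousOn (fun z : ℂ => z⁻¹ • resolvent a z) (Metric.sphere 0 (A / 2)) := by
  intro z hz
  have hz' : ‖z‖ = A / 2 := by simpa using hz
  have h0 : z ≠ 0 := by
    rintro rfl
    rw [norm_zero] at hz'
    linarith
  exact ((continuousAt_inv₀ h0).smul (spectrum.hasDerivAt_resolvent_const_left
    (hres z h0 (by linarith))).continuousAt).continuousWithinAt

/-- A contour integral around an isolated spectral value `0` that is a simple pole of the
resolvent gives a generalised inverse. -/
lemma mul_mul_circleIntegral_resolvent (hA : 0 < A)
    (hres : ∀ z : ℂ, z ≠ 0 → ‖z‖ < A → z ∈ resolventSet ℂ a)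
    (hb : ∀ z : ℂ, z ≠ 0 → ‖z‖ < 3 * A / 4 → ‖z • resolvent a z‖ ≤ M) :
    a * a * (∮ z in C(0, A / 2), z⁻¹ • resolvent a z) = -((2 * Real.pi * I) • a) := by
  have hA2 : 0 ≤ A / 2 := by linarith
  have hsph {z : ℂ} (hz : z ∈ Metric.sphere (0 : ℂ) (A / 2)) : z ≠ 0 ∧ ‖z‖ < A := by
    have hz' : ‖z‖ = A / 2 := by simpa using hz
    refine ⟨?_, by linarith⟩
    rintro rfl
    rw [norm_zero] at hz'
    linarith
  have hint := (continuousOn_inv_smul_resolvent hA hres).circleIntegrable hA2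
  have hmul : a * a * (∮ z in C(0, A / 2), z⁻¹ • resolvent a z) =
      ∮ z in C(0, A / 2), a * a * (z⁻¹ • resolvent a z) :=
    ((ContinuousLinearMap.mul ℂ B (a * a)).circleIntegral_comp_comm hint).symm
  have hpt : Set.EqOn (fun z : ℂ => a * a * (z⁻¹ • resolvent a z))
      (fun z => z • resolvent a z - (1 + (z - 0)⁻¹ • a)) (Metric.sphere 0 (A / 2)) := by
    intro z hz
    obtain ⟨h0, h1⟩ := hsph hz
    have h := sub_mul_resolvent (hres z h0 h1)
    rw [Algebra.algebraMap_eq_smul_one, sub_mul, smul_mul_assoc, one_mul] at h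
    have h2 : a * resolvent a z = z • resolvent a z - 1 := by rw [← h]; abel
    have h3 : a * a * resolvent a z = z • (z • resolvent a z - 1) - a := by
      rw [mul_assoc, h2, mul_sub, mul_smul_comm, h2, mul_one]
    simp only [mul_smul_comm, h3, sub_zero]
    rw [smul_sub, smul_smul, inv_mul_cancel₀ h0, one_smul]
    abel
  have hzero : ∮ z in C(0, A / 2), z • resolvent a z = 0 := by
    set f : ℂ → B := fun z => z • resolvent a z
    have hd : DifferentiableOn ℂ f (Metric.ball 0 (3 * A / 4) \ {0}) := fun z hz => by
      have hz1 : ‖z‖ < 3 * A / 4 := by simpa using hz.1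
      exact (differentiableAt_id.smul (spectrum.hasDerivAt_resolvent_const_left
        (hres z hz.2 (by linarith))).differentiableAt).differentiableWithinAt
    have hbd : BddAbove (norm ∘ f '' (Metric.ball 0 (3 * A / 4) \ {0})) := by
      refine ⟨M, ?_⟩
      rintro _ ⟨z, hz, rfl⟩
      exact hb z hz.2 (by simpa using hz.1)
    have hdiff := Complex.differentiableOn_update_limUnder_of_bddAbove
      (Metric.ball_mem_nhds (0 : ℂ) (by linarith : 0 < 3 * A / 4)) hd hbd
    have hsub : Metric.closedBall (0 : ℂ) (A / 2) ⊆ Metric.ball 0 (3 * A / 4) :=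
      Metric.closedBall_subset_ball (by linarith)
    have hc := Complex.circleIntegral_eq_zero_of_differentiable_on_off_countable hA2
      (Set.countable_empty) (hdiff.continuousOn.mono hsub) fun z hz =>
        (hdiff z (hsub (Metric.ball_subset_closedBall hz.1))).differentiableAt
          (Metric.isOpen_ball.mem_nhds (hsub (Metric.ball_subset_closedBall hz.1)))
    rw [← hc]
    exact circleIntegral.integral_congr hA2 fun z hz =>
      (Function.update_of_ne (hsph hz).1 _ f).symm
  have hc1 : ContinuousOn (fun z : ℂ => (1 : B) + (z - 0)⁻¹ • a) (Metric.sphere 0 (A / 2)) :=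
    fun z hz => (continuousAt_const.add (((continuousAt_id.sub continuousAt_const).inv₀
      (by simpa using (hsph hz).1)).smul continuousAt_const)).continuousWithinAt
  have hc2 : ContinuousOn (fun z : ℂ => z • resolvent a z) (Metric.sphere 0 (A / 2)) :=
    fun z hz => (continuousAt_id.smul (spectrum.hasDerivAt_resolvent_const_left
      (hres z (hsph hz).1 (hsph hz).2)).continuousAt).continuousWithinAt
  have hc3 : ContinuousOn (fun z : ℂ => (z - 0)⁻¹ • a) (Metric.sphere 0 (A / 2)) :=
    fun z hz => (((continuousAt_id.sub continuousAt_const).inv₀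
      (by simpa using (hsph hz).1)).smul continuousAt_const).continuousWithinAt
  rw [hmul, circleIntegral.integral_congr hA2 hpt,
    circleIntegral.integral_sub (hc2.circleIntegrable hA2) (hc1.circleIntegrable hA2), hzero,
    circleIntegral.integral_add (circleIntegrable_const _ _ _) (hc3.circleIntegrable hA2),
    circleIntegral.integral_smul_const, circleIntegral.integral_sub_center_inv _ (by linarith),
    Complex.circleIntegral_eq_zero_of_differentiable_on_off_countable hA2
      Set.countable_empty continuousOn_const fun z _ => differentiableAt_const _, zero_add, zero_sub]

end Contour

section SpectralGap

variable {H : Type*} [NormedAddCommGroup H] [InnerProductSpace ℂ H]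
  {T : H →L[ℂ] H} {A : ℝ}

lemma norm_mul_norm_le_of_gap (hgap : ∀ w, A * ‖T w‖ ≤ ‖T (T w)‖) {z : ℂ} (hz : ‖z‖ < A) (w : H) :
    ‖z‖ * ‖w‖ ≤ (1 + ‖T‖ / (A - ‖z‖)) * ‖(algebraMap ℂ (H →L[ℂ] H) z - T) w‖ := by
  set u := (algebraMap ℂ (H →L[ℂ] H) z - T) w with hu
  have hu' : u = z • w - T w := by simp [hu, Algebra.algebraMap_eq_smul_one]
  have hTu : T u = z • T w - T (T w) := by rw [hu', map_sub, map_smul]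
  have h1 : (A - ‖z‖) * ‖T w‖ ≤ ‖T‖ * ‖u‖ := by
    have h2 := norm_sub_norm_le (T (T w)) (z • T w)
    rw [norm_sub_rev, ← hTu, norm_smul] at h2
    linarith [T.le_opNorm u, hgap w]
  have h3 : ‖T w‖ ≤ ‖T‖ / (A - ‖z‖) * ‖u‖ := by
    rw [div_mul_eq_mul_div, le_div_iff₀ (by linarith)]
    linarith
  have h4 : ‖z‖ * ‖w‖ ≤ ‖u‖ + ‖T w‖ := by
    rw [← norm_smul]
    have : z • w = u + T w := by rw [hu']; abel
    rw [this]
    exact norm_add_le _ _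
  linarith

variable [CompleteSpace H]

lemma mem_resolventSet_of_gap (hT : IsSelfAdjoint T) (hgap : ∀ w, A * ‖T w‖ ≤ ‖T (T w)‖) {z : ℂ}
    (hz0 : z ≠ 0) (hz : ‖z‖ < A) : z ∈ resolventSet ℂ T := by
  have hpos : 0 < ‖z‖ := norm_pos_iff.2 hz0
  change IsUnit (algebraMap ℂ (H →L[ℂ] H) z - T)
  rw [ContinuousLinearMap.isUnit_iff_bijective,
    ContinuousLinearMap.bijective_iff_dense_range_and_antilipschitz]
  constructor
  · rw [Submodule.topologicalClosure_eq_top_iff, Submodule.eq_bot_iff]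
    intro x hx
    have hadj : ContinuousLinearMap.adjoint (algebraMap ℂ (H →L[ℂ] H) z - T) =
        algebraMap ℂ (H →L[ℂ] H) (conj z) - T := by
      rw [← ContinuousLinearMap.star_eq_adjoint, star_sub, hT.star_eq,
        Algebra.algebraMap_eq_smul_one, Algebra.algebraMap_eq_smul_one, star_smul, star_one]
      rfl
    have h0 : (algebraMap ℂ (H →L[ℂ] H) (conj z) - T) x = 0 := by
      rw [← hadj]
      refine ext_inner_left ℂ fun v => ?_
      rw [ContinuousLinearMap.adjoint_inner_right, inner_zero_right]
      exact hx _ ⟨v, rfl⟩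
    have h := norm_mul_norm_le_of_gap hgap (z := conj z) (by simpa using hz) x
    rw [h0, norm_zero, mul_zero, RCLike.norm_conj] at h
    exact norm_le_zero_iff.1 (by nlinarith [norm_nonneg x])
  · refine ⟨⟨(1 + ‖T‖ / (A - ‖z‖)) / ‖z‖, ?_⟩, ContinuousLinearMap.antilipschitz_of_bound _ fun w => ?_⟩
    · have : 0 < A - ‖z‖ := by linarith
      positivity
    · change _ ≤ (1 + ‖T‖ / (A - ‖z‖)) / ‖z‖ * _
      rw [div_mul_eq_mul_div, le_div_iff₀ hpos, mul_comm]
      exact norm_mul_norm_le_of_gap hgap hz w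

lemma norm_smul_resolvent_le_of_gap (hT : IsSelfAdjoint T) (hgap : ∀ w, A * ‖T w‖ ≤ ‖T (T w)‖)
    {z : ℂ} (hz0 : z ≠ 0) (hz : ‖z‖ < 3 * A / 4) :
    ‖z • resolvent T z‖ ≤ 1 + ‖T‖ / (A / 4) := by
  have hA : 0 < A := by linarith [norm_nonneg z]
  have hzA : ‖z‖ < A := by linarith
  refine ContinuousLinearMap.opNorm_le_bound _ (by positivity) fun v => ?_
  have h := norm_mul_norm_le_of_gap hgap hzA (resolvent T z v)
  rw [← mul_apply_eq_comp, sub_mul_resolvent (mem_resolventSet_of_gap hT hgap hz0 hzA)] at h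
  rw [smul_apply, norm_smul]
  refine h.trans ?_
  rw [one_apply_eq_self]
  gcongr
  linarith

end SpectralGap

/-- Let `E` be a projection of a Banach algebra onto a subalgebra which is inverse-closed with
respect to a representation `ρ` on a Hilbert space. If an element of the subalgebra acts as a
self-adjoint operator with a spectral gap at `0`, then this operator has a generalised inverse in
the subalgebra. -/
theorem exists_generalised_inverse {W H : Type*} [NormedRing W] [NormedAlgebra ℂ W]
    [CompleteSpace W] [NormedAddCommGroup H] [InnerProductSpace ℂ H] [CompleteSpace H]
    (E : W →L[ℂ] W) (ρ : W →L[ℂ] (H →L[ℂ] H)) (hE : E 1 = 1) (hρ : ρ 1 = 1)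
    (hmul : ∀ x y, ρ (x * y) = ρ x * ρ y) (hunit : ∀ x, E x = x → IsUnit (ρ x) → IsUnit x)
    (hinv : ∀ x y, E x = x → x * y = 1 → y * x = 1 → E y = y) (x : W) (hx : E x = x)
    (hsa : IsSelfAdjoint (ρ x)) {A : ℝ} (hA : 0 < A)
    (hgap : ∀ w, A * ‖ρ x w‖ ≤ ‖ρ x (ρ x w)‖) :
    ∃ y, E y = y ∧ ρ x * ρ x * ρ y = ρ x := by
  have hfix (z : ℂ) : E (algebraMap ℂ W z - x) = algebraMap ℂ W z - x := by
    rw [map_sub, hx, Algebra.algebraMap_eq_smul_one, map_smul, hE]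
  have hev (z : ℂ) : ρ (algebraMap ℂ W z - x) = algebraMap ℂ (H →L[ℂ] H) z - ρ x := by
    rw [map_sub, Algebra.algebraMap_eq_smul_one, map_smul, hρ, ← Algebra.algebraMap_eq_smul_one]
  have hgap' (z : ℂ) (h0 : z ≠ 0) (h1 : ‖z‖ < A) : z ∈ resolventSet ℂ (ρ x) :=
    mem_resolventSet_of_gap hsa hgap h0 h1
  have hres (z : ℂ) (h0 : z ≠ 0) (h1 : ‖z‖ < A) : z ∈ resolventSet ℂ x :=
    hunit _ (hfix z) (by rw [hev]; exact hgap' z h0 h1)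
  have hsph {z : ℂ} (hz : z ∈ Metric.sphere (0 : ℂ) (A / 2)) : z ≠ 0 ∧ ‖z‖ < A := by
    have hz' : ‖z‖ = A / 2 := by simpa using hz
    refine ⟨?_, by linarith⟩
    rintro rfl
    rw [norm_zero] at hz'
    linarith
  have hA2 : 0 ≤ A / 2 := by linarith
  have hint := (continuousOn_inv_smul_resolvent hA hres).circleIntegrable hA2
  have hproj : E (∮ z in C(0, A / 2), z⁻¹ • resolvent x z) =
      ∮ z in C(0, A / 2), z⁻¹ • resolvent x z := by
    rw [← ContinuousLinearMap.circleIntegral_comp_comm _ hint]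
    refine circleIntegral.integral_congr hA2 fun z hz => ?_
    have hz' := hres z (hsph hz).1 (hsph hz).2
    simp only [map_smul]
    rw [hinv _ _ (hfix z) (sub_mul_resolvent hz') (resolvent_mul_sub hz')]
  have hevR : ρ (∮ z in C(0, A / 2), z⁻¹ • resolvent x z) =
      ∮ z in C(0, A / 2), z⁻¹ • resolvent (ρ x) z := by
    rw [← ContinuousLinearMap.circleIntegral_comp_comm _ hint]
    refine circleIntegral.integral_congr hA2 fun z hz => ?_
    have hz' := hres z (hsph hz).1 (hsph hz).2
    have hz'' := hgap' z (hsph hz).1 (hsph hz).2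
    simp only [map_smul]
    congr 1
    refine left_inv_eq_right_inv (a := algebraMap ℂ _ z - ρ x) ?_ (sub_mul_resolvent hz'')
    rw [← hev, ← hmul, resolvent_mul_sub hz', hρ]
  refine ⟨-(2 * Real.pi * I)⁻¹ • ∮ z in C(0, A / 2), z⁻¹ • resolvent x z, ?_, ?_⟩
  · rw [map_smul, hproj]
  · rw [map_smul, hevR, mul_smul_comm, mul_mul_circleIntegral_resolvent hA hgap' fun z h0 h1 =>
      norm_smul_resolvent_le_of_gap hsa hgap h0 h1, neg_smul_neg, smul_smul,
      inv_mul_cancel₀ Complex.two_pi_I_ne_zero, one_smul]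

namespace ConvAlg

open SeqL2

lemma exists_twisted_generalised_inverse {G : Type*} [AddCommGroup G] [DecidableEq G]
    (θ : G → AddChar G Circle) (hθ : ∀ m n, θ (m + n) = θ m * θ n)
    (x : ConvAlg G (SeqL2 G →L[ℂ] SeqL2 G)) (hx : twistedProj θ x = x)
    (hsa : IsSelfAdjoint (ev 1 x)) {A : ℝ} (hA : 0 < A)
    (hgap : ∀ w, A * ‖ev 1 x w‖ ≤ ‖ev 1 x (ev 1 x w)‖) :
    ∃ y, twistedProj θ y = y ∧ ev 1 x * ev 1 x * ev 1 y = ev 1 x :=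
  exists_generalised_inverse (twistedProj θ) (ev 1) (twistedProj_one θ hθ) (ev_one 1) (ev_mul 1)
    (isUnit_of_isUnit_ev_one θ) (fun _ _ => twistedProj_eq_of_mul_eq_one θ hθ) x hx hsa hA hgap

end ConvAlg

section Plancherel

open FourierTransform SchwartzMap

open scoped ContDiff in
lemma coeFn_fourier_toLp {F : ℝ → ℂ} (h1 : Integrable F) (h2 : MemLp F 2) :
    ((𝓕 (h2.toLp F) : L2) : ℝ → ℂ) =ᵐ[volume] 𝓕 F := by
  have hcont : Continuous (𝓕 F) :=
    VectorFourier.fourierIntegral_continuous Real.continuous_fourierChar continuous_inner h1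
  refine ae_eq_of_integral_contDiff_smul_eq ((Lp.memLp _).locallyIntegrable one_le_two)
    hcont.locallyIntegrable fun u hu hsupp => ?_
  let ψ : 𝓢(ℝ, ℂ) := HasCompactSupport.toSchwartzMap (f := fun x => (u x : ℂ))
    (hsupp.comp_left Complex.ofReal_zero) (Complex.ofRealCLM.contDiff.comp hu)
  have hψ (x : ℝ) : ψ x = u x := rfl
  have hTD := DFunLike.congr_fun (Lp.fourier_toTemperedDistribution_eq (h2.toLp F)) ψ
  rw [TemperedDistribution.fourier_apply, Lp.toTemperedDistribution_apply,
    Lp.toTemperedDistribution_apply] at hTD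
  have hself : ∫ x, 𝓕 ψ x • F x = ∫ x, ψ x • 𝓕 F x := by
    simpa using! VectorFourier.integral_fourierIntegral_smul_eq_flip (L := innerₗ ℝ)
      Real.continuous_fourierChar continuous_inner ψ.integrable h1
  have hF : ∫ x, 𝓕 ψ x • (h2.toLp F) x = ∫ x, 𝓕 ψ x • F x :=
    integral_congr_ae (by filter_upwards [h2.coeFn_toLp] with x hx; rw [hx])
  rw [hF, hself] at hTD
  simpa [hψ] using hTD.symm

lemma enorm_integral_conj_mul_le_fourier {F₁ F₂ : ℝ → ℂ} (h₁ : Integrable F₁) (h₁' : MemLp F₁ 2)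
    (h₂ : Integrable F₂) (h₂' : MemLp F₂ 2) :
    ‖∫ x, conj (F₁ x) * F₂ x‖ₑ ≤ ∫⁻ b, ‖𝓕 F₁ b‖ₑ * ‖𝓕 F₂ b‖ₑ := by
  have h := Lp.inner_fourier_eq (h₁'.toLp F₁) (h₂'.toLp F₂)
  rw [L2.inner_def, L2.inner_def] at h
  have e1 : ∫ x, ⟪(h₁'.toLp F₁ : L2) x, (h₂'.toLp F₂ : L2) x⟫_ℂ = ∫ x, conj (F₁ x) * F₂ x :=
    integral_congr_ae (by
      filter_upwards [h₁'.coeFn_toLp, h₂'.coeFn_toLp] with x hx hy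
      rw [hx, hy, RCLike.inner_apply, mul_comm])
  rw [← e1, ← h]
  refine (enorm_integral_le_lintegral_enorm _).trans (lintegral_mono_ae ?_)
  filter_upwards [coeFn_fourier_toLp h₁ h₁', coeFn_fourier_toLp h₂ h₂'] with x hx hy
  rw [hx, hy, RCLike.inner_apply, enorm_mul, RCLike.enorm_conj, mul_comm]

end Plancherel

section TimeFrequencyShift

/-- The unimodular number `e^{2πit}`. -/
def phase (t : ℝ) : ℂ := Complex.exp (2 * Real.pi * Complex.I * t)

lemma phase_eq_circleExp (t : ℝ) : phase t = Circle.exp (2 * Real.pi * t) := by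
  rw [phase, Circle.coe_exp]
  push_cast
  ring_nf

lemma norm_phase (t : ℝ) : ‖phase t‖ = 1 := by rw [phase_eq_circleExp, Circle.norm_coe]

lemma phase_add (s t : ℝ) : phase (s + t) = phase s * phase t := by
  simp only [phase_eq_circleExp, mul_add, Circle.exp_add, Circle.coe_mul]

lemma conj_phase (t : ℝ) : conj (phase t) = phase (-t) := by
  simp only [phase_eq_circleExp, ← Circle.coe_inv_eq_conj, ← Circle.exp_neg, mul_neg]

lemma phase_zero : phase 0 = 1 := by simp [phase]

lemma conj_phase_mul_phase (t : ℝ) : conj (phase t) * phase t = 1 := by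
  rw [conj_phase, ← phase_add, neg_add_cancel, phase_zero]

lemma continuous_phase : Continuous phase := by
  unfold phase
  fun_prop

lemma coeFn_tf (z : ℝ × ℝ) (f : L2) :
    tf z f =ᵐ[volume] fun x => phase (z.2 * (x - z.1)) * f (x - z.1) := by
  have h1 := (memLp_translate z.1 (Mo z.2 f)).coeFn_toLp
  have h2 := (measurePreserving_sub_right volume z.1).quasiMeasurePreserving.ae_eq_comp
    (memLp_modulate z.2 f).coeFn_toLp
  filter_upwards [h1, h2] with x hx hx'
  refine hx.trans (hx'.trans ?_)
  simp [phase]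

lemma tf_tf (z w : ℝ × ℝ) (f : L2) : tf z (tf w f) = phase (z.2 * w.1) • tf (z + w) f := by
  refine Lp.ext ?_
  have h := (measurePreserving_sub_right volume z.1).quasiMeasurePreserving.ae_eq_comp
    (coeFn_tf w f)
  filter_upwards [coeFn_tf z (tf w f), h, coeFn_tf (z + w) f,
    Lp.coeFn_smul (phase (z.2 * w.1)) (tf (z + w) f)] with x h1 h2 h3 h4
  rw [h1, h4, Pi.smul_apply, h3, smul_eq_mul]
  have h2' : (tf w f) (x - z.1) = phase (w.2 * (x - z.1 - w.1)) * f (x - z.1 - w.1) := h2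
  rw [h2', ← mul_assoc, ← mul_assoc, ← phase_add, ← phase_add, Prod.fst_add, Prod.snd_add]
  ring_nf

lemma inner_tf_tf (z : ℝ × ℝ) (f h : L2) : ⟪tf z f, tf z h⟫_ℂ = ⟪f, h⟫_ℂ := by
  rw [L2.inner_def, L2.inner_def,
    ← integral_sub_right_eq_self (fun x => ⟪f x, h x⟫_ℂ) z.1]
  refine integral_congr_ae ?_
  filter_upwards [coeFn_tf z f, coeFn_tf z h] with x hx hx'
  simp only [hx, hx', RCLike.inner_apply, map_mul]
  linear_combination (conj (f (x - z.1)) * h (x - z.1)) * conj_phase_mul_phase (z.2 * (x - z.1))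

lemma inner_tf_tf_eq (w k : ℝ × ℝ) (f h : L2) :
    ⟪tf w f, tf k h⟫_ℂ = phase (k.2 * (w.1 - k.1)) * ⟪tf (w - k) f, h⟫_ℂ := by
  have h1 := tf_tf k (w - k) f
  rw [add_sub_cancel] at h1
  rw [← inner_tf_tf k (tf (w - k) f) h, h1, inner_smul_left, ← mul_assoc, mul_comm (phase _),
    Prod.fst_sub, conj_phase_mul_phase, one_mul]

lemma norm_inner_tf_tf (w k : ℝ × ℝ) (f h : L2) :
    ‖⟪tf w f, tf k h⟫_ℂ‖ = ‖⟪tf (w - k) f, h⟫_ℂ‖ := by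
  rw [inner_tf_tf_eq, norm_mul, norm_phase, one_mul]

lemma tf_zero (f : L2) : tf 0 f = f := by
  refine Lp.ext ?_
  filter_upwards [coeFn_tf 0 f] with x hx
  simp [hx, phase_zero]

end TimeFrequencyShift

section ShortTimeFourier

open FourierTransform

/-- The Gaussian `e^{-πx²}` as a complex-valued function. -/
def gaussFun (x : ℝ) : ℂ := (Real.exp (-Real.pi * x ^ 2) : ℂ)

lemma conj_gaussFun (x : ℝ) : conj (gaussFun x) = gaussFun x := by
  unfold gaussFun
  exact Complex.conj_ofReal _

lemma norm_gaussFun_le (x : ℝ) : ‖gaussFun x‖ ≤ 1 := by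
  rw [gaussFun, Complex.norm_real, Real.norm_eq_abs, Real.abs_exp, Real.exp_le_one_iff]
  nlinarith [Real.pi_pos, sq_nonneg x]

lemma memLp_gaussFun_sub (a : ℝ) : MemLp (fun x => gaussFun (x - a)) 2 volume :=
  memLp_gaussian.comp_measurePreserving (measurePreserving_sub_right volume a)

lemma integrable_gaussFun_mul (a : ℝ) (f : L2) : Integrable fun x => gaussFun (x - a) * f x :=
  (memLp_gaussFun_sub a).integrable_mul (Lp.memLp f)

lemma memLp_gaussFun_mul (a : ℝ) (f : L2) : MemLp (fun x => gaussFun (x - a) * f x) 2 volume := by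
  refine (Lp.memLp f).of_le ((integrable_gaussFun_mul a f).aestronglyMeasurable)
    (Eventually.of_forall fun x => ?_)
  rw [norm_mul]
  exact mul_le_of_le_one_left (norm_nonneg _) (norm_gaussFun_le _)

lemma inner_tf_gaussL2 (a b : ℝ) (f : L2) :
    ⟪tf (a, b) gaussL2, f⟫_ℂ = phase (a * b) * 𝓕 (fun x => gaussFun (x - a) * f x) b := by
  rw [L2.inner_def, Real.fourier_real_eq_integral_exp_smul, ← integral_const_mul]
  have h := (measurePreserving_sub_right volume a).quasiMeasurePreserving.ae_eq_comp
    memLp_gaussian.coeFn_toLp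
  refine integral_congr_ae ?_
  filter_upwards [coeFn_tf (a, b) gaussL2, h] with x hx hx'
  have hx'' : gaussL2 (x - a) = gaussFun (x - a) := hx'
  rw [hx, hx'', RCLike.inner_apply, map_mul, conj_gaussFun, conj_phase, smul_eq_mul]
  have e : Complex.exp (((-2 * Real.pi * x * b : ℝ) : ℂ) * I) = phase (-(x * b)) := by
    rw [phase]
    push_cast
    ring_nf
  rw [e, ← mul_assoc (phase (a * b)), ← phase_add]
  ring_nf

lemma enorm_inner_tf_gaussL2 (a b : ℝ) (f : L2) :
    ‖⟪tf (a, b) gaussL2, f⟫_ℂ‖ₑ = ‖𝓕 (fun x => gaussFun (x - a) * f x) b‖ₑ := by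
  rw [inner_tf_gaussL2, enorm_mul, ← ofReal_norm (phase _), norm_phase, ENNReal.ofReal_one,
    one_mul]

end ShortTimeFourier

section ShortTimeFourierBounds

open FourierTransform

lemma integrable_gaussFun_mul_self : Integrable fun x => gaussFun x * gaussFun x :=
  memLp_gaussian.integrable_mul memLp_gaussian

lemma integral_gaussFun_mul_self_ne_zero : ∫ x, gaussFun x * gaussFun x ≠ 0 := by
  have h (x : ℝ) : gaussFun x * gaussFun x = (Real.exp (-(2 * Real.pi) * x ^ 2) : ℂ) := by
    rw [gaussFun, ← Complex.ofReal_mul, ← Real.exp_add]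
    ring_nf
  simp only [h]
  rw [integral_complex_ofReal, integral_gaussian]
  exact_mod_cast (Real.sqrt_pos.2 (by positivity)).ne'

/-- The inequality form of the orthogonality relations for the short-time Fourier transform. -/
lemma mul_enorm_inner_le_lintegral (f h : L2) :
    ‖∫ x, gaussFun x * gaussFun x‖ₑ * ‖⟪f, h⟫_ℂ‖ₑ ≤
      ∫⁻ a : ℝ, ∫⁻ b : ℝ, ‖⟪tf (a, b) gaussL2, f⟫_ℂ‖ₑ * ‖⟪tf (a, b) gaussL2, h⟫_ℂ‖ₑ := by
  have hint : Integrable fun x => conj (f x) * h x := by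
    simpa only [RCLike.inner_apply, mul_comm] using L2.integrable_inner (𝕜 := ℂ) f h
  have hconv := integral_convolution (ContinuousLinearMap.mul ℂ ℂ) hint integrable_gaussFun_mul_self
  have hinner : ⟪f, h⟫_ℂ = ∫ x, conj (f x) * h x := by
    rw [L2.inner_def]
    simp only [RCLike.inner_apply, mul_comm]
  rw [hinner, mul_comm, ← enorm_mul]
  rw [ContinuousLinearMap.mul_apply'] at hconv
  rw [← hconv]
  refine (enorm_integral_le_lintegral_enorm _).trans (lintegral_mono fun a => ?_)
  simp only [enorm_inner_tf_gaussL2]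
  refine le_trans (le_of_eq ?_) (enorm_integral_conj_mul_le_fourier (integrable_gaussFun_mul a f)
    (memLp_gaussFun_mul a f) (integrable_gaussFun_mul a h) (memLp_gaussFun_mul a h))
  rw [convolution_def]
  congr 2
  ext x
  have e : gaussFun (x - a) = gaussFun (a - x) := by
    rw [gaussFun, gaussFun, ← neg_sub a x, neg_sq]
  rw [ContinuousLinearMap.mul_apply', map_mul, conj_gaussFun, e]
  ring

/-- The two-dimensional Gaussian bounding the short-time Fourier transform of the Gaussian. -/
def gaussBound (w : ℝ × ℝ) : ℝ≥0∞ :=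
  ENNReal.ofReal (Real.exp (-Real.pi / 2 * w.1 ^ 2)) *
    ENNReal.ofReal (Real.exp (-Real.pi / 2 * w.2 ^ 2))

lemma measurable_gaussBound : Measurable gaussBound := by
  unfold gaussBound
  fun_prop

lemma gaussBound_neg (w : ℝ × ℝ) : gaussBound (-w) = gaussBound w := by
  simp [gaussBound]

lemma enorm_inner_tf_gaussL2_self_le (w : ℝ × ℝ) :
    ‖⟪tf w gaussL2, gaussL2⟫_ℂ‖ₑ ≤ gaussBound w := by
  obtain ⟨a, b⟩ := w
  have hF : 𝓕 (fun x => gaussFun (x - a) * gaussL2 x) b =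
      𝓕 (fun x : ℝ => (Real.exp (-Real.pi * a ^ 2) : ℂ) *
        cexp (-Real.pi * 2 * x ^ 2 + 2 * Real.pi * a * x)) b := by
    refine Real.fourier_congr_ae ?_ b
    filter_upwards [memLp_gaussian.coeFn_toLp] with x hx
    have hx' : gaussL2 x = gaussFun x := hx
    rw [hx', gaussFun, gaussFun, Complex.ofReal_exp, Complex.ofReal_exp,
      Complex.ofReal_exp, ← Complex.exp_add, ← Complex.exp_add]
    push_cast
    ring_nf
  have hmul : 𝓕 (fun x : ℝ => (Real.exp (-Real.pi * a ^ 2) : ℂ) *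
        cexp (-Real.pi * 2 * x ^ 2 + 2 * Real.pi * a * x)) b =
      (Real.exp (-Real.pi * a ^ 2) : ℂ) *
        𝓕 (fun x : ℝ => cexp (-Real.pi * 2 * x ^ 2 + 2 * Real.pi * a * x)) b := by
    rw [Real.fourier_real_eq_integral_exp_smul, Real.fourier_real_eq_integral_exp_smul,
      ← integral_const_mul]
    refine integral_congr_ae (Eventually.of_forall fun x => ?_)
    simp only [smul_eq_mul]
    ring
  have hG := congrFun (fourier_gaussian_pi' (b := 2) (by norm_num) (a : ℂ)) b
  have hexp : ‖cexp (-Real.pi / 2 * (b + I * a) ^ 2)‖ =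
      Real.exp (-Real.pi / 2 * (b ^ 2 - a ^ 2)) := by
    rw [Complex.norm_exp]
    congr 1
    have : (-Real.pi / 2 * (b + I * a) ^ 2 : ℂ) =
        ((-Real.pi / 2 * (b ^ 2 - a ^ 2) : ℝ) : ℂ) + ((-Real.pi * a * b : ℝ) : ℂ) * I := by
      push_cast
      linear_combination (-Real.pi / 2 * a ^ 2 : ℂ) * Complex.I_sq
    rw [this, Complex.add_re, Complex.ofReal_re, Complex.re_ofReal_mul, Complex.I_re, mul_zero,
      add_zero]
  have hroot : ‖(1 / (2 : ℂ) ^ (1 / 2 : ℂ))‖ ≤ 1 := by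
    have h2 : ‖(2 : ℂ) ^ (1 / 2 : ℂ)‖ = (2 : ℝ) ^ (1 / 2 : ℝ) := by
      have := Complex.norm_cpow_eq_rpow_re_of_pos (x := 2) two_pos (1 / 2 : ℂ)
      simpa using this
    rw [norm_div, norm_one, h2]
    exact div_le_one_of_le₀ (Real.one_le_rpow one_le_two (by norm_num)) (by positivity)
  rw [enorm_inner_tf_gaussL2, hF, hmul, hG, gaussBound, ← ofReal_norm,
    ← ENNReal.ofReal_mul (Real.exp_pos _).le, norm_mul, norm_mul, hexp, Complex.norm_real,
    Real.norm_eq_abs, Real.abs_exp]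
  refine ENNReal.ofReal_le_ofReal ?_
  calc Real.exp (-Real.pi * a ^ 2) * (_ * Real.exp (-Real.pi / 2 * (b ^ 2 - a ^ 2)))
    _ ≤ Real.exp (-Real.pi * a ^ 2) * (1 * Real.exp (-Real.pi / 2 * (b ^ 2 - a ^ 2))) := by
      gcongr
    _ = _ := by
      rw [one_mul, ← Real.exp_add, ← Real.exp_add]
      ring_nf

lemma tsum_gauss_le {α : ℝ} (hα : 0 < α) :
    ∃ D : ℝ≥0∞, D ≠ ∞ ∧ ∀ x : ℝ,
      ∑' m : ℤ, ENNReal.ofReal (Real.exp (-Real.pi / 2 * (x - α * m) ^ 2)) ≤ D := by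
  have hs := summable_pow_mul_jacobiTheta₂_term_bound (α ^ 2 / 2) (T := α ^ 2 / 2) (by positivity) 0
  simp only [pow_zero, one_mul] at hs
  refine ⟨∑' m : ℤ, ENNReal.ofReal
    (Real.exp (-Real.pi * (α ^ 2 / 2 * m ^ 2 - 2 * (α ^ 2 / 2) * |m|))), ?_, fun x => ?_⟩
  · rw [← ENNReal.ofReal_tsum_of_nonneg (fun _ => (Real.exp_pos _).le) (by simpa using hs)]
    exact ENNReal.ofReal_ne_top
  · rw [← (Equiv.addRight ⌊x / α⌋).tsum_eq]
    refine ENNReal.tsum_le_tsum fun m => ENNReal.ofReal_le_ofReal (Real.exp_le_exp.2 ?_)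
    set y := x - α * ⌊x / α⌋ with hy
    have hx : x = α * (x / α) := by field_simp
    have hy0 : 0 ≤ y := by
      have := Int.floor_le (x / α)
      nlinarith
    have hy1 : y ≤ α := by
      have := (Int.lt_floor_add_one (x / α)).le
      nlinarith
    have e : x - α * ((Equiv.addRight ⌊x / α⌋ m : ℤ) : ℝ) = y - α * m := by
      rw [Equiv.coe_addRight, hy]
      push_cast
      ring
    rw [e]
    have h1 : y * m ≤ α * |(m : ℝ)| :=
      (mul_le_mul_of_nonneg_left (le_abs_self _) hy0).trans
        (mul_le_mul_of_nonneg_right hy1 (abs_nonneg _))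
    have h2 : α ^ 2 * m ^ 2 - 2 * α ^ 2 * |(m : ℝ)| ≤ (y - α * m) ^ 2 := by
      nlinarith [sq_nonneg y, mul_le_mul_of_nonneg_left h1 hα.le]
    push_cast
    nlinarith [Real.pi_pos, mul_le_mul_of_nonneg_left h2 Real.pi_pos.le]

/-- The point of the lattice `αℤ × βℤ` with integer coordinates `k`. -/
def latticePoint (α β : ℝ) (k : ℤ × ℤ) : ℝ × ℝ := (α * k.1, β * k.2)

lemma tsum_gaussBound_le {α β : ℝ} (hα : 0 < α) (hβ : 0 < β) :
    ∃ D : ℝ≥0∞, D ≠ ∞ ∧ ∀ w, ∑' k, gaussBound (w - latticePoint α β k) ≤ D := by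
  obtain ⟨D₁, h₁, h₁'⟩ := tsum_gauss_le hα
  obtain ⟨D₂, h₂, h₂'⟩ := tsum_gauss_le hβ
  refine ⟨D₁ * D₂, ENNReal.mul_ne_top h₁ h₂, fun w => ?_⟩
  simp only [gaussBound, latticePoint, ENNReal.tsum_prod', ENNReal.tsum_mul_left,
    ENNReal.tsum_mul_right, Prod.fst_sub, Prod.snd_sub]
  exact mul_le_mul' (h₁' _) (h₂' _)

lemma mul_enorm_stft_le {g : L2} (hg : InS0 g) (z : ℝ × ℝ) :
    ‖∫ x, gaussFun x * gaussFun x‖ₑ * ‖⟪tf z gaussL2, g⟫_ℂ‖ₑ ≤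
      ∫⁻ w, gaussBound (w - z) * ‖⟪tf w gaussL2, g⟫_ℂ‖ₑ := by
  refine (mul_enorm_inner_le_lintegral _ _).trans ?_
  rw [Measure.volume_eq_prod, lintegral_prod]
  · gcongr with a b
    rw [← ofReal_norm, norm_inner_tf_tf, ofReal_norm]
    exact enorm_inner_tf_gaussL2_self_le _
  · exact (measurable_gaussBound.comp (measurable_id.sub_const z)).aemeasurable.mul
      hg.aestronglyMeasurable.enorm

/-- The samples of the ambiguity function of a window in `S₀` are absolutely summable. -/
theorem summable_norm_inner_tf {g : L2} (hg : InS0 g) {α β : ℝ} (hα : 0 < α) (hβ : 0 < β) :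
    Summable fun k => ‖⟪tf (latticePoint α β k) g, g⟫_ℂ‖ := by
  obtain ⟨D, hD, hD'⟩ := tsum_gaussBound_le hα hβ
  set c := ‖∫ x, gaussFun x * gaussFun x‖ₑ with hc
  have hc0 : c ≠ 0 := enorm_ne_zero.2 integral_gaussFun_mul_self_ne_zero
  have hct : c ≠ ∞ := enorm_ne_top
  set v : ℝ × ℝ → ℝ≥0∞ := fun w => ‖⟪tf w gaussL2, g⟫_ℂ‖ₑ with hv
  have hvm : AEMeasurable v := hg.aestronglyMeasurable.enorm
  have hvi : ∫⁻ w, v w ≠ ∞ := hg.hasFiniteIntegral.ne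
  have hvk (k : ℤ × ℤ) : AEMeasurable fun w => v (w - latticePoint α β k) :=
    hvm.comp_quasiMeasurePreserving (measurePreserving_sub_right volume _).quasiMeasurePreserving
  have hvv (k : ℤ × ℤ) : AEMeasurable fun w => v (w - latticePoint α β k) * v w :=
    (hvk k).mul hvm
  have hgv (z : ℝ × ℝ) : AEMeasurable fun u => gaussBound (u - z) * v u :=
    (measurable_gaussBound.comp (measurable_id.sub_const z)).aemeasurable.mul hvm
  have hsum (w : ℝ × ℝ) : c * ∑' k, v (w - latticePoint α β k) ≤ D * ∫⁻ w, v w := by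
    rw [← ENNReal.tsum_mul_left]
    calc ∑' k, c * v (w - latticePoint α β k)
      _ ≤ ∑' k, ∫⁻ u, gaussBound (u - (w - latticePoint α β k)) * v u :=
        ENNReal.tsum_le_tsum fun k => mul_enorm_stft_le hg _
      _ = ∫⁻ u, (∑' k, gaussBound (w - u - latticePoint α β k)) * v u := by
        rw [← lintegral_tsum fun k => hgv _]
        refine lintegral_congr fun u => ?_
        rw [← ENNReal.tsum_mul_right]
        refine tsum_congr fun k => ?_
        rw [← gaussBound_neg]
        congr 2
        abel
      _ ≤ ∫⁻ u, D * v u := lintegral_mono fun u => mul_le_mul_left (hD' _) _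
      _ = D * ∫⁻ w, v w := lintegral_const_mul'' _ hvm
  have hfin : ∑' k, ‖⟪tf (latticePoint α β k) g, g⟫_ℂ‖ₑ ≠ ∞ := by
    have hle : c * (c * ∑' k, ‖⟪tf (latticePoint α β k) g, g⟫_ℂ‖ₑ) ≤
        (D * ∫⁻ w, v w) * ∫⁻ w, v w := by
      calc c * (c * ∑' k, ‖⟪tf (latticePoint α β k) g, g⟫_ℂ‖ₑ)
        _ ≤ c * ∑' k, ∫⁻ w, v (w - latticePoint α β k) * v w := by
          gcongr
          rw [← ENNReal.tsum_mul_left]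
          refine ENNReal.tsum_le_tsum fun k => ?_
          refine (mul_enorm_inner_le_lintegral _ _).trans (le_of_eq ?_)
          rw [Measure.volume_eq_prod, lintegral_prod _ (hvv k)]
          refine lintegral_congr fun a => lintegral_congr fun b => ?_
          rw [← ofReal_norm, norm_inner_tf_tf, ofReal_norm]
        _ = ∫⁻ w, c * (∑' k, v (w - latticePoint α β k)) * v w := by
          rw [← lintegral_tsum hvv, ← lintegral_const_mul'' _ ?_]
          · refine lintegral_congr fun w => ?_
            rw [ENNReal.tsum_mul_right, mul_assoc]
          · exact AEMeasurable.tsum hvv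
        _ ≤ ∫⁻ w, (D * ∫⁻ w, v w) * v w := lintegral_mono fun w => mul_le_mul_left (hsum w) _
        _ = (D * ∫⁻ w, v w) * ∫⁻ w, v w := lintegral_const_mul'' _ hvm
    intro htop
    rw [htop, ENNReal.mul_top hc0, ENNReal.mul_top hc0, top_le_iff] at hle
    exact ENNReal.mul_ne_top (ENNReal.mul_ne_top hD hvi) hvi hle
  have := ENNReal.summable_toReal hfin
  simpa using this

end ShortTimeFourierBounds

section FrameSequence

open ContinuousLinearMap

variable {H ι : Type*} [NormedAddCommGroup H] [InnerProductSpace ℂ H]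
  {e : ι → H} {A B : ℝ}

lemma mul_norm_sq_le_analysisOperator {C : H →L[ℂ] SeqL2 ι}
    (hC : ∀ f i, C f i = ⟪e i, f⟫_ℂ)
    (hlow : ∀ f ∈ (Submodule.span ℂ (Set.range e)).topologicalClosure,
      A * ‖f‖ ^ 2 ≤ ∑' i, ‖⟪e i, f⟫_ℂ‖ ^ 2) {f : H}
    (hf : f ∈ (Submodule.span ℂ (Set.range e)).topologicalClosure) :
    A * ‖f‖ ^ 2 ≤ ‖C f‖ ^ 2 := by
  simpa only [SeqL2.norm_sq_eq_tsum, hC] using hlow f hf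

variable [CompleteSpace H]

/-- A frame sequence has a bounded analysis operator on the whole Hilbert space. -/
lemma exists_analysisOperator (hA : 0 < A) (hB : 0 ≤ B)
    (hlow : ∀ f ∈ (Submodule.span ℂ (Set.range e)).topologicalClosure,
      A * ‖f‖ ^ 2 ≤ ∑' i, ‖⟪e i, f⟫_ℂ‖ ^ 2)
    (hupp : ∀ f ∈ (Submodule.span ℂ (Set.range e)).topologicalClosure,
      ∑' i, ‖⟪e i, f⟫_ℂ‖ ^ 2 ≤ B * ‖f‖ ^ 2) :
    ∃ C : H →L[ℂ] SeqL2 ι, ∀ f i, C f i = ⟪e i, f⟫_ℂ := by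
  set K := (Submodule.span ℂ (Set.range e)).topologicalClosure with hK
  have hsumK (f : H) (hf : f ∈ K) : Summable fun i => ‖⟪e i, f⟫_ℂ‖ ^ 2 := by
    by_contra hns
    have h := hlow f hf
    rw [tsum_eq_zero_of_not_summable hns] at h
    have hf0 : f = 0 := by
      rw [← norm_eq_zero, ← sq_eq_zero_iff]
      nlinarith [sq_nonneg ‖f‖]
    exact hns (by simp [hf0, summable_zero])
  have hproj (f : H) (i : ι) : ⟪e i, K.starProjection f⟫_ℂ = ⟪e i, f⟫_ℂ := by
    have hi : e i ∈ K := Submodule.le_topologicalClosure _ (Submodule.subset_span ⟨i, rfl⟩)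
    rw [← Submodule.inner_starProjection_left_eq_right, Submodule.starProjection_eq_self_iff.2 hi]
  have hmem (f : H) : K.starProjection f ∈ K := Submodule.starProjection_apply_mem K f
  have hsum (f : H) : Summable fun i => ‖⟪e i, f⟫_ℂ‖ ^ 2 := by
    simpa only [hproj] using hsumK _ (hmem f)
  refine ⟨LinearMap.mkContinuous
    { toFun := fun f => ⟨fun i => ⟪e i, f⟫_ℂ, SeqL2.memℓp_of_summable_sq (hsum f)⟩
      map_add' := fun f h => by
        ext i
        exact inner_add_right _ _ _
      map_smul' := fun c f => by
        ext i
        exact inner_smul_right _ _ _ } (√B) fun f => ?_, fun f i => rfl⟩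
  rw [← abs_of_nonneg (norm_nonneg f), ← Real.sqrt_sq_eq_abs, ← Real.sqrt_mul' _ (sq_nonneg _)]
  refine Real.le_sqrt_of_sq_le ?_
  rw [SeqL2.norm_sq_eq_tsum]
  have hf := hupp _ (hmem f)
  simp only [hproj] at hf
  refine hf.trans ?_
  have hle : ‖K.starProjection f‖ ^ 2 ≤ ‖f‖ ^ 2 :=
    pow_le_pow_left₀ (norm_nonneg _) (K.norm_starProjection_apply_le f) 2
  exact mul_le_mul_of_nonneg_left hle hB

variable [DecidableEq ι] {C : H →L[ℂ] SeqL2 ι}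

lemma adjoint_analysisOperator_single (hC : ∀ f i, C f i = ⟪e i, f⟫_ℂ) (i : ι) :
    adjoint C (lp.single 2 i 1) = e i := by
  refine ext_inner_right ℂ fun f => ?_
  rw [adjoint_inner_left, lp.inner_single_left, hC]
  simp

lemma hasSum_adjoint_analysisOperator (hC : ∀ f i, C f i = ⟪e i, f⟫_ℂ) (v : SeqL2 ι) :
    HasSum (fun i => v i • e i) (adjoint C v) := by
  have h := (lp.hasSum_single (E := fun _ : ι => ℂ) ENNReal.ofNat_ne_top v).mapL (adjoint C)
  convert h using 2 with i
  rw [← adjoint_analysisOperator_single hC i, ← map_smul, ← lp.single_smul, smul_eq_mul, mul_one]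

lemma adjoint_analysisOperator_mem (hC : ∀ f i, C f i = ⟪e i, f⟫_ℂ) (v : SeqL2 ι) :
    adjoint C v ∈ (Submodule.span ℂ (Set.range e)).topologicalClosure := by
  have h := hasSum_adjoint_analysisOperator hC v
  refine (Submodule.isClosed_topologicalClosure _).mem_of_tendsto h
    (Eventually.of_forall fun s => ?_)
  exact Submodule.sum_mem _ fun i _ => Submodule.smul_mem _ _
    (Submodule.le_topologicalClosure _ (Submodule.subset_span ⟨i, rfl⟩))

/-- The Gram operator of a frame sequence has a spectral gap at zero. -/
lemma mul_norm_gram_le (hC : ∀ f i, C f i = ⟪e i, f⟫_ℂ) (hA : 0 < A)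
    (hlow : ∀ f ∈ (Submodule.span ℂ (Set.range e)).topologicalClosure,
      A * ‖f‖ ^ 2 ≤ ∑' i, ‖⟪e i, f⟫_ℂ‖ ^ 2) (w : SeqL2 ι) :
    A * ‖C (adjoint C w)‖ ≤ ‖C (adjoint C (C (adjoint C w)))‖ := by
  set f := adjoint C w with hf
  have h1 := mul_norm_sq_le_analysisOperator hC hlow (adjoint_analysisOperator_mem hC w)
  have h2 := mul_norm_sq_le_analysisOperator hC hlow (adjoint_analysisOperator_mem hC (C f))
  have h3 : ‖C f‖ ^ 2 ≤ ‖f‖ * ‖adjoint C (C f)‖ := by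
    have h := norm_inner_le_norm (𝕜 := ℂ) f (adjoint C (C f))
    rw [adjoint_inner_right, inner_self_eq_norm_sq_to_K] at h
    simpa using h
  rw [← hf] at h1
  set a := ‖f‖
  set b := ‖C f‖
  set c := ‖adjoint C (C f)‖
  have ha : 0 ≤ a := norm_nonneg _
  have hb : 0 ≤ b := norm_nonneg _
  have hc : 0 ≤ c := norm_nonneg _
  have h4 : A * b ^ 2 ≤ c ^ 2 := by
    rcases hb.eq_or_lt with hb0 | hb0
    · rw [← hb0]
      nlinarith [sq_nonneg c]
    · have h5 : (b ^ 2) ^ 2 ≤ (a * c) ^ 2 := pow_le_pow_left₀ (sq_nonneg _) h3 2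
      have h6 : A * b ^ 2 * b ^ 2 ≤ c ^ 2 * b ^ 2 := by
        nlinarith [mul_le_mul_of_nonneg_right h1 (sq_nonneg c), mul_le_mul_of_nonneg_left h5 hA.le]
      exact le_of_mul_le_mul_right h6 (by positivity)
  refine le_of_sq_le_sq ?_ (norm_nonneg _)
  nlinarith [mul_le_mul_of_nonneg_left h4 hA.le]

/-- The canonical dual of a frame sequence expressed through a generalised inverse `T` of its
Gram operator. -/
lemma eq_adjoint_of_gram_mul_gram_mul (hC : ∀ f i, C f i = ⟪e i, f⟫_ℂ) (hA : 0 < A)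
    (hlow : ∀ f ∈ (Submodule.span ℂ (Set.range e)).topologicalClosure,
      A * ‖f‖ ^ 2 ≤ ∑' i, ‖⟪e i, f⟫_ℂ‖ ^ 2) {T : SeqL2 ι →L[ℂ] SeqL2 ι}
    (hT : C ∘L adjoint C * C ∘L adjoint C * T = C ∘L adjoint C) {i : ι} {γ : H}
    (hγ : γ ∈ (Submodule.span ℂ (Set.range e)).topologicalClosure)
    (hsum : HasSum (fun j => ⟪e j, γ⟫_ℂ • e j) (e i)) :
    γ = adjoint C (T (lp.single 2 i 1)) := by
  have hker (f : H) (h : adjoint C (C f) = 0) : C f = 0 := by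
    rw [← inner_self_eq_zero (𝕜 := ℂ), ← adjoint_inner_right, h, inner_zero_right]
  have hker' (u : SeqL2 ι) (h : C (adjoint C u) = 0) : adjoint C u = 0 := by
    rw [← inner_self_eq_zero (𝕜 := ℂ), adjoint_inner_left, h, inner_zero_right]
  set f := adjoint C (T (lp.single 2 i 1)) with hf
  have h1 : adjoint C (C f) = e i := by
    rw [← adjoint_analysisOperator_single hC i, ← sub_eq_zero, ← map_sub]
    refine hker' _ ?_
    rw [map_sub, map_sub, sub_eq_zero]
    exact DFunLike.congr_fun hT (lp.single 2 i 1)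
  have h2 : adjoint C (C γ) = e i := by
    refine (hasSum_adjoint_analysisOperator hC (C γ)).unique ?_
    simpa only [hC] using hsum
  have h3 : C (γ - f) = 0 := hker _ (by rw [map_sub, map_sub, h1, h2, sub_self])
  have h4 := mul_norm_sq_le_analysisOperator hC hlow
    (Submodule.sub_mem _ hγ (adjoint_analysisOperator_mem hC (T (lp.single 2 i 1))))
  rw [← hf, h3, norm_zero] at h4
  rw [← sub_eq_zero, ← norm_eq_zero, ← sq_eq_zero_iff]
  nlinarith [sq_nonneg ‖γ - f‖]

end FrameSequence

section DualWindow

open ConvAlg SeqL2 ContinuousLinearMap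

/-- The bicharacter describing the commutation of the time-frequency shifts along `αℤ × βℤ`. -/
def latticeChar (α β : ℝ) (m : ℤ × ℤ) : AddChar (ℤ × ℤ) Circle where
  toFun n := Circle.exp (2 * Real.pi * (β * n.2 * (α * m.1)))
  map_zero_eq_one' := by simp
  map_add_eq_mul' n n' := by
    rw [← Circle.exp_add]
    push_cast [Prod.snd_add]
    ring_nf

lemma latticeChar_apply (α β : ℝ) (m n : ℤ × ℤ) :
    (latticeChar α β m n : ℂ) = phase (β * n.2 * (α * m.1)) :=
  (phase_eq_circleExp _).symm

lemma latticeChar_add (α β : ℝ) (m n : ℤ × ℤ) :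
    latticeChar α β (m + n) = latticeChar α β m * latticeChar α β n := by
  ext k
  rw [AddChar.mul_apply, Circle.coe_mul, latticeChar_apply, latticeChar_apply, latticeChar_apply,
    ← phase_add]
  push_cast [Prod.fst_add]
  ring_nf

lemma latticePoint_sub (α β : ℝ) (m n : ℤ × ℤ) :
    latticePoint α β (m - n) = latticePoint α β m - latticePoint α β n := by
  ext <;> simp [latticePoint, mul_sub]

lemma inner_tf_latticePoint (α β : ℝ) (g : L2) (m n : ℤ × ℤ) :
    ⟪tf (latticePoint α β m) g, tf (latticePoint α β n) g⟫_ℂ =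
      (latticeChar α β (m - n) n : ℂ) * ⟪tf (latticePoint α β (m - n)) g, g⟫_ℂ := by
  rw [inner_tf_tf_eq, latticePoint_sub, latticeChar_apply]
  simp [latticePoint, mul_sub]

/-- The Gram matrix of `(g, αℤ × βℤ)` as an element of the convolution algebra. -/
def gramConv {g : L2} (hg : InS0 g) {α β : ℝ} (hα : 0 < α) (hβ : 0 < β) :
    ConvAlg (ℤ × ℤ) (SeqL2 (ℤ × ℤ) →L[ℂ] SeqL2 (ℤ × ℤ)) :=
  ⟨fun k => ⟪tf (latticePoint α β k) g, g⟫_ℂ • twistedShift (latticeChar α β) k, by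
    refine memℓp_gen ?_
    simp only [ENNReal.toReal_one, Real.rpow_one]
    refine Summable.of_nonneg_of_le (fun _ => norm_nonneg _) (fun k => ?_)
      (summable_norm_inner_tf hg hα hβ)
    rw [norm_smul]
    exact mul_le_of_le_one_right (norm_nonneg _) (norm_weightedPerm_le _ _)⟩

lemma twistedProj_gramConv {g : L2} (hg : InS0 g) {α β : ℝ} (hα : 0 < α) (hβ : 0 < β) :
    twistedProj (latticeChar α β) (gramConv hg hα hβ) = gramConv hg hα hβ := by
  ext1
  funext k
  rw [twistedProj_apply]
  simp only [gramConv, map_smul, coeffZero_twistedShift_self, smul_eq_mul, mul_one]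

lemma ev_one_gramConv {g : L2} (hg : InS0 g) {α β : ℝ} (hα : 0 < α) (hβ : 0 < β)
    {C : L2 →L[ℂ] SeqL2 (ℤ × ℤ)} (hC : ∀ f k, C f k = ⟪tf (latticePoint α β k) g, f⟫_ℂ) :
    ev 1 (gramConv hg hα hβ) = C ∘L adjoint C := by
  refine lp.ext_continuousLinearMap (E := fun _ : ℤ × ℤ => ℂ) ENNReal.ofNat_ne_top fun n => ?_
  ext m
  have h := ((hasSum_ev 1 (gramConv hg hα hβ)).mapL
    (ContinuousLinearMap.apply ℂ (SeqL2 (ℤ × ℤ)) (lp.single 2 n 1))).mapL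
    (lp.evalCLM ℂ (fun _ : ℤ × ℤ => ℂ) 2 m)
  have hval : C (adjoint C (lp.single 2 n 1)) m =
      (latticeChar α β (m - n) n : ℂ) * ⟪tf (latticePoint α β (m - n)) g, g⟫_ℂ := by
    rw [adjoint_analysisOperator_single hC, hC, inner_tf_latticePoint]
  refine (h.unique ?_).trans hval.symm
  have hterm (k : ℤ × ℤ) : (lp.evalCLM ℂ (fun _ : ℤ × ℤ => ℂ) 2 m)
      ((ContinuousLinearMap.apply ℂ (SeqL2 (ℤ × ℤ)) (lp.single 2 n 1))
        (((1 : AddChar (ℤ × ℤ) Circle) k : ℂ) • gramConv hg hα hβ k)) =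
      ⟪tf (latticePoint α β k) g, g⟫_ℂ *
        ((latticeChar α β k (m - k) : ℂ) * (lp.single 2 n 1 : SeqL2 (ℤ × ℤ)) (m - k)) := by
    rw [AddChar.one_apply, Circle.coe_one, one_smul]
    rfl
  simp only [hterm]
  have hne (k : ℤ × ℤ) (hk : k ≠ m - n) : ⟪tf (latticePoint α β k) g, g⟫_ℂ *
      ((latticeChar α β k (m - k) : ℂ) * (lp.single 2 n 1 : SeqL2 (ℤ × ℤ)) (m - k)) = 0 := by
    rw [lp.single_apply_ne _ _ _ fun h => hk (by rw [← h, sub_sub_cancel]), mul_zero, mul_zero]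
  have hs := _root_.hasSum_single (m - n) hne
  rw [sub_sub_cancel, lp.single_apply_self, mul_one,
    mul_comm ⟪tf (latticePoint α β (m - n)) g, g⟫_ℂ] at hs
  exact hs

/-- An absolutely summable superposition of time-frequency shifts of a window in `S₀` is in
`S₀`. -/
lemma InS0.of_hasSum {ι : Type*} [Countable ι] {g f : L2} (hg : InS0 g) {c : ι → ℂ}
    {z : ι → ℝ × ℝ} (hc : Summable fun k => ‖c k‖)
    (hf : HasSum (fun k => c k • tf (z k) g) f) : InS0 f := by
  have hsum (w : ℝ × ℝ) :
      HasSum (fun k => c k * ⟪tf w gaussL2, tf (z k) g⟫_ℂ) ⟪tf w gaussL2, f⟫_ℂ := by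
    simpa only [innerSL_apply_apply, inner_smul_right] using
      hf.mapL (innerSL ℂ (tf w gaussL2))
  have hint (k : ι) : Integrable fun w => c k * ⟪tf w gaussL2, tf (z k) g⟫_ℂ := by
    simp only [inner_tf_tf_eq _ (z k)]
    refine Integrable.const_mul ?_ _
    refine Integrable.bdd_mul (c := 1) (Integrable.comp_sub_right hg (z k)) ?_ ?_
    · exact (continuous_phase.comp (by fun_prop)).aestronglyMeasurable
    · exact Eventually.of_forall fun w => (norm_phase _).le
  refine ⟨aestronglyMeasurable_of_tendsto_ae atTop (f := fun s w => ∑ k ∈ s,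
    c k * ⟪tf w gaussL2, tf (z k) g⟫_ℂ) (fun s => ?_)
    (Eventually.of_forall fun w => hsum w), ?_⟩
  · exact (integrable_finsetSum s fun k _ => hint k).aestronglyMeasurable
  · have hle (w : ℝ × ℝ) : ‖⟪tf w gaussL2, f⟫_ℂ‖ₑ ≤
        ∑' k, ‖c k * ⟪tf w gaussL2, tf (z k) g⟫_ℂ‖ₑ := by
      rw [← (hsum w).tsum_eq]
      exact enorm_tsum_le_tsum_enorm
    have hterm (k : ι) : ∫⁻ w, ‖c k * ⟪tf w gaussL2, tf (z k) g⟫_ℂ‖ₑ =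
        ‖c k‖ₑ * ∫⁻ w, ‖⟪tf w gaussL2, g⟫_ℂ‖ₑ := by
      simp only [enorm_mul]
      rw [lintegral_const_mul' _ _ enorm_ne_top,
        ← lintegral_sub_right_eq_self (fun w => ‖⟪tf w gaussL2, g⟫_ℂ‖ₑ) (z k)]
      simp only [← ofReal_norm, norm_inner_tf_tf]
    refine (lintegral_mono hle).trans_lt ?_
    rw [lintegral_tsum fun k => (hint k).aestronglyMeasurable.enorm]
    simp only [hterm]
    rw [ENNReal.tsum_mul_right]
    refine ENNReal.mul_lt_top ?_ hg.hasFiniteIntegral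
    simp only [← ofReal_norm]
    exact hc.tsum_ofReal_lt_top

/-- The integer parametrisation of the lattice `αℤ × βℤ`. -/
def latticeEquiv {α β : ℝ} (hα : 0 < α) (hβ : 0 < β) : ℤ × ℤ ≃ sepLattice α β :=
  Equiv.ofBijective (fun k => ⟨latticePoint α β k, k.1, k.2, rfl⟩) <| by
    constructor
    · rintro ⟨a, b⟩ ⟨a', b'⟩ h
      have h' := congrArg Subtype.val h
      simpa [latticePoint, hα.ne', hβ.ne'] using h'
    · rintro ⟨_, k, l, rfl⟩
      exact ⟨(k, l), rfl⟩

lemma coe_latticeEquiv {α β : ℝ} (hα : 0 < α) (hβ : 0 < β) (k : ℤ × ℤ) :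
    (latticeEquiv hα hβ k : ℝ × ℝ) = latticePoint α β k := rfl

lemma gaborSpan_sepLattice {α β : ℝ} (g : L2) :
    gaborSpan g (sepLattice α β) =
      (Submodule.span ℂ (Set.range fun k => tf (latticePoint α β k) g)).topologicalClosure := by
  have h : (fun z => tf z g) '' sepLattice α β =
      Set.range fun k => tf (latticePoint α β k) g := by
    ext f
    constructor
    · rintro ⟨_, ⟨k, l, rfl⟩, rfl⟩
      exact ⟨(k, l), rfl⟩
    · rintro ⟨k, rfl⟩
      exact ⟨_, ⟨k.1, k.2, rfl⟩, rfl⟩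
  rw [gaborSpan, h, Submodule.topologicalClosure_coe]

end DualWindow

/-- the canonical dual window of a Gabor frame sequence with
`S₀`-generator again lies in `S₀(ℝ)`. -/
theorem statement_9 (g : L2) (hg : InS0 g) (α β : ℝ) (hα : 0 < α) (hβ : 0 < β)
    (hframe : IsFrameSeq g (sepLattice α β)) (γ : L2)
    (hγ : IsDualWindow g γ α β) :
    InS0 γ := by
  obtain ⟨A, B, hA, hB, hAB⟩ := hframe
  obtain ⟨hmem, hdual⟩ := hγ
  rw [gaborSpan_sepLattice] at hmem hAB
  simp only [← (latticeEquiv hα hβ).tsum_eq (fun lam : sepLattice α β => ‖⟪tf lam g, _⟫_ℂ‖ ^ 2),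
    coe_latticeEquiv] at hAB
  rw [← (latticeEquiv hα hβ).hasSum_iff] at hdual
  simp only [Function.comp_def, coe_latticeEquiv] at hdual
  have hlow := fun f hf => (hAB f hf).1
  obtain ⟨C, hC⟩ := exists_analysisOperator hA hB.le hlow fun f hf => (hAB f hf).2
  have hgram := ev_one_gramConv hg hα hβ hC
  obtain ⟨y, hy, hinv⟩ := ConvAlg.exists_twisted_generalised_inverse (latticeChar α β)
    (latticeChar_add α β) (gramConv hg hα hβ) (twistedProj_gramConv hg hα hβ)
    (by
      rw [hgram, ContinuousLinearMap.isSelfAdjoint_iff', ContinuousLinearMap.adjoint_comp,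
        ContinuousLinearMap.adjoint_adjoint]) hA
    (by
      rw [hgram]
      exact mul_norm_gram_le hC hA hlow)
  rw [hgram] at hinv
  have h0 : tf (latticePoint α β 0) g = g := by
    have : latticePoint α β 0 = 0 := by simp [latticePoint]
    rw [this, tf_zero]
  have hγ := eq_adjoint_of_gram_mul_gram_mul hC hA hlow hinv hmem (i := 0) (by rwa [h0])
  have hsum := (ConvAlg.ev_one_twistedProj_single (latticeChar α β) y).mapL
    (ContinuousLinearMap.adjoint C)
  rw [hy, ← hγ] at hsum
  simp only [map_smul, adjoint_analysisOperator_single hC] at hsum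
  exact hg.of_hasSum (Summable.of_nonneg_of_le (fun _ => norm_nonneg _)
    (fun k => SeqL2.norm_coeffZero_apply_le k (y k)) (ConvAlg.summable_norm y)) hsum

end
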